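/- Let (X_{ij})_{1≤i≤j≤n} (for each n) be centered jointly Gaussian random variables such that for some fixed C > 0 and ε > 0: (a) sup_{1≤i≤j≤n} |Var(X_{ij}) − 1| ≤ C/(log n)² for all n ≥ 2, and (b) |E[X_{ij} X_{i'j'}]| ≤ C·n^{-(1+ε)} for all (i,j) ≠ (i',j'). Then for the associated symmetric matrix X_n, the largest eigenvalue λ₁(n^{-1/2} X_n) converges to 2 almost surely as n → ∞. -/

import Mathlib

open MeasureTheory ProbabilityTheory Filter Topology

noncomputable section

/-- The largest eigenvalue of a real symmetric matrix, realised as the supremum of its set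
of real eigenvalues. -/
def lam1 {n : ℕ} (A : Matrix (Fin n) (Fin n) ℝ) : ℝ :=
  sSup {t : ℝ | ∃ v : Fin n → ℝ, v ≠ 0 ∧ A.mulVec v = t • v}

/-- A finite family of real random variables is a centered (jointly) Gaussian vector:
every linear combination of the coordinates has a centered Gaussian law. -/
def IsCenteredGaussianVec {Ω : Type*} [MeasureSpace Ω] {ι : Type*} [Fintype ι]
    (X : ι → Ω → ℝ) : Prop :=
  (∀ i, Measurable (X i)) ∧
    ∀ c : ι → ℝ, ∃ v : NNReal,
      Measure.map (fun ω => ∑ i, c i * X i ω) (volume : Measure Ω) = gaussianReal 0 v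

/-- Covariance of two real random variables. -/
def pcov {Ω : Type*} [MeasureSpace Ω] (W V : Ω → ℝ) : ℝ :=
  (∫ ω, W ω * V ω) - (∫ ω, W ω) * ∫ ω, V ω

/-- Variance of a real random variable. -/
def pvar {Ω : Type*} [MeasureSpace Ω] (W : Ω → ℝ) : ℝ := pcov W W

/-- The correlated Gaussian model with parameter `ε` and constant `C`: for each `n`,
`X n` is a random symmetric `n × n` matrix whose entries `(X_{ij})_{i ≤ j}` form a centered
Gaussian vector with unit variances and pairwise correlations bounded by `C * n ^ (-(1+ε))`. -/
structure CorrGaussian (Ω : Type*) [MeasureSpace Ω]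
    (X : (n : ℕ) → Ω → Matrix (Fin n) (Fin n) ℝ) (C ε : ℝ) : Prop where
  symm : ∀ n ω, (X n ω).IsSymm
  gauss : ∀ n, IsCenteredGaussianVec fun p : Fin n × Fin n => fun ω => X n ω p.1 p.2
  var_one : ∀ n, ∀ i j : Fin n, ∫ ω, (X n ω i j) ^ 2 = 1
  corr_le : ∀ n, ∀ i j i' j' : Fin n, ¬((i, j) = (i', j') ∨ (i, j) = (j', i')) →
    |∫ ω, X n ω i j * X n ω i' j'| ≤ C * (n : ℝ) ^ (-(1 + ε))

/-- The all-ones `n × n` matrix `𝟙𝟙ᵀ`. -/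
def onesMat (n : ℕ) : Matrix (Fin n) (Fin n) ℝ := Matrix.of fun _ _ => 1

/-- The operator (spectral) norm of a real matrix, i.e. the norm of the induced map on
Euclidean space. -/
def opNorm {n : ℕ} (A : Matrix (Fin n) (Fin n) ℝ) : ℝ :=
  ‖(Matrix.toEuclideanLin A).toContinuousLinearMap‖

/-- `T n = O_P(a n)`: for every `δ > 0` there are `M > 0` and `n₀` such that
`P(|T n| > M * a n) ≤ δ` for all `n ≥ n₀`. -/
def IsBigOP {Ω : Type*} [MeasureSpace Ω] (T : ℕ → Ω → ℝ) (a : ℕ → ℝ) : Prop :=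
  ∀ δ : ℝ, 0 < δ → ∃ M : ℝ, 0 < M ∧ ∃ n₀ : ℕ, ∀ n ≥ n₀,
    (volume {ω | M * a n < |T n ω|}).toReal ≤ δ

/-- The sparse Rademacher(p) law `p δ_{-1} + (1 - 2p) δ_0 + p δ_1`. -/
def sparseRademacher (p : ℝ) : Measure ℝ :=
  ENNReal.ofReal p • Measure.dirac (-1) + ENNReal.ofReal (1 - 2 * p) • Measure.dirac 0 +
    ENNReal.ofReal p • Measure.dirac 1

end


namespace GM
open MvPolynomial

/-- Polynomials with nonnegative coefficients. -/
def NN {σ : Type*} (p : MvPolynomial σ ℝ) : Prop := ∀ m, 0 ≤ p.coeff m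

section NN
variable {σ : Type*}

lemma NN.zero : NN (0 : MvPolynomial σ ℝ) := fun m => by simp

lemma NN.C {c : ℝ} (hc : 0 ≤ c) : NN (MvPolynomial.C c : MvPolynomial σ ℝ) := fun m => by
  classical
  rw [coeff_C]; split_ifs <;> simp [hc]

lemma NN.one : NN (1 : MvPolynomial σ ℝ) := by
  have := NN.C (σ := σ) (zero_le_one)
  simpa using this

lemma NN.add {p q : MvPolynomial σ ℝ} (hp : NN p) (hq : NN q) : NN (p + q) := fun m => by
  rw [coeff_add]; exact add_nonneg (hp m) (hq m)

lemma NN.mul {p q : MvPolynomial σ ℝ} (hp : NN p) (hq : NN q) : NN (p * q) := fun m => by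
  classical
  rw [coeff_mul]; exact Finset.sum_nonneg fun x _ => mul_nonneg (hp _) (hq _)

lemma NN.X (a : σ) : NN (MvPolynomial.X a : MvPolynomial σ ℝ) := fun m => by
  classical
  rw [coeff_X]; split_ifs <;> simp

lemma NN.sum {τ : Type*} (s : Finset τ) {f : τ → MvPolynomial σ ℝ} (h : ∀ i ∈ s, NN (f i)) :
    NN (∑ i ∈ s, f i) := fun m => by
  rw [coeff_sum]; exact Finset.sum_nonneg fun i hi => h i hi m

lemma NN.monomial (m : σ →₀ ℕ) {c : ℝ} (hc : 0 ≤ c) : NN (MvPolynomial.monomial m c) := fun k => by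
  classical
  rw [coeff_monomial]; split_ifs <;> simp [hc]

lemma NN.pderiv {p : MvPolynomial σ ℝ} (hp : NN p) (a : σ) : NN (MvPolynomial.pderiv a p) :=
  fun m => by
  rw [coeff_pderiv]
  have := hp (m + Finsupp.single a 1)
  positivity

lemma totalDegree_pderiv_le (p : MvPolynomial σ ℝ) (a : σ) :
    (pderiv a p).totalDegree ≤ p.totalDegree - 1 := by
  classical
  refine Finset.sup_le fun m hm => ?_
  rw [mem_support_iff, coeff_pderiv] at hm
  have h2 : m + Finsupp.single a 1 ∈ p.support := by
    rw [mem_support_iff]; intro h; apply hm; rw [h]; simp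
  have := le_totalDegree h2
  rw [Finsupp.sum_add_index' (by simp) (by simp)] at this
  simp at this
  omega

/-- Induction principle on polynomials with nonnegative coefficients. -/
lemma NN.induction (P : MvPolynomial σ ℝ → Prop)
    (hC : ∀ c : ℝ, 0 ≤ c → P (MvPolynomial.C c))
    (hadd : ∀ p q, NN p → NN q → P p → P q → P (p + q))
    (hX : ∀ a p, NN p → (∀ b, P (MvPolynomial.pderiv b p)) → P (MvPolynomial.X a * p))
    (p : MvPolynomial σ ℝ) (hp : NN p) : P p := by
  classical
  have h0 : P 0 := by simpa using hC 0 le_rfl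
  have key : ∀ d : ℕ, ∀ p, NN p → p.totalDegree ≤ d → P p := by
    intro d
    induction d using Nat.strong_induction_on with
    | _ d ih =>
    intro p hp hd
    have hs : ∀ s : Finset (σ →₀ ℕ), s ⊆ p.support →
        P (∑ m ∈ s, MvPolynomial.monomial m (p.coeff m)) ∧
        NN (∑ m ∈ s, MvPolynomial.monomial m (p.coeff m)) := by
      intro s
      induction s using Finset.induction_on with
      | empty => intro _; simpa using ⟨h0, NN.zero⟩
      | insert m s hm ihs =>
        intro hsub
        rw [Finset.sum_insert hm]
        obtain ⟨h1, h2⟩ := ihs (fun x hx => hsub (Finset.mem_insert_of_mem hx))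
        have hmp : m ∈ p.support := hsub (Finset.mem_insert_self _ _)
        have hnn : NN (MvPolynomial.monomial m (p.coeff m)) := NN.monomial m (hp m)
        refine ⟨hadd _ _ hnn h2 ?_ h1, hnn.add h2⟩
        have hmd : m.degree ≤ d := by
          have := le_totalDegree hmp
          have e : m.degree = m.sum fun _ e => e := rfl
          omega
        by_cases hm0 : m = 0
        · subst hm0
          exact hC _ (hp 0)
        · obtain ⟨a, ha⟩ := Finsupp.ne_iff.mp hm0
          have e : MvPolynomial.monomial m (p.coeff m) =
              MvPolynomial.X a * MvPolynomial.monomial (m - Finsupp.single a 1) (p.coeff m) := by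
            rw [MvPolynomial.X, monomial_mul]; simp
            congr 1
            rw [add_comm, tsub_add_cancel_of_le]
            simp at ha ⊢; omega
          have hdeg : (m - Finsupp.single a 1).degree + 1 = m.degree := by
            have : m - Finsupp.single a 1 + Finsupp.single a 1 = m := by
              rw [tsub_add_cancel_of_le]; simp at ha ⊢; omega
            conv_rhs => rw [← this]
            simp
          rw [e]
          have hn' : NN (MvPolynomial.monomial (m - Finsupp.single a 1) (p.coeff m)) :=
            NN.monomial _ (hp m)
          apply hX _ _ hn'
          intro b
          refine ih (d - 1) (by omega) _ (hn'.pderiv b) ?_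
          refine (totalDegree_pderiv_le _ _).trans ?_
          have := totalDegree_monomial_le (m - Finsupp.single a 1) (p.coeff m)
          change _ ≤ (m - Finsupp.single a 1).degree at this
          omega
    have := (hs p.support subset_rfl).1
    rwa [← p.as_sum] at this
  exact key _ p hp le_rfl

lemma pderiv_comm (a b : σ) (p : MvPolynomial σ ℝ) :
    pderiv a (pderiv b p) = pderiv b (pderiv a p) := by
  classical
  ext m
  simp only [coeff_pderiv]
  rw [show m + Finsupp.single a 1 + Finsupp.single b 1 = m + Finsupp.single b 1 + Finsupp.single a 1 by
    abel]
  by_cases h : a = b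
  · subst h; rfl
  · have h' : ¬ b = a := fun h' => h h'.symm
    simp [h, h']; ring

end NN

section Fun
variable {σ : Type*} [Fintype σ]

/-- `E` is the (formal) centered Gaussian expectation with covariance kernel `K`. -/
structure IsGF (K : σ → σ → ℝ) (E : MvPolynomial σ ℝ →ₗ[ℝ] ℝ) : Prop where
  one : E 1 = 1
  ibp : ∀ a g, E (X a * g) = ∑ b, K a b * E (pderiv b g)

lemma IsGF.C {K : σ → σ → ℝ} {E : MvPolynomial σ ℝ →ₗ[ℝ] ℝ} (h : IsGF K E) (c : ℝ) :
    E (MvPolynomial.C c) = c := by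
  rw [C_eq_smul_one, map_smul, h.one]; simp

lemma IsGF.nonneg {K : σ → σ → ℝ} {E : MvPolynomial σ ℝ →ₗ[ℝ] ℝ} (h : IsGF K E)
    (hK : ∀ a b, 0 ≤ K a b) (p : MvPolynomial σ ℝ) (hp : NN p) : 0 ≤ E p := by
  refine NN.induction (fun p => 0 ≤ E p) ?_ ?_ ?_ p hp
  · intro c hc; simpa [h.C] using hc
  · intro p q _ _ h1 h2; rw [map_add]; exact add_nonneg h1 h2
  · intro a p _ hp; rw [h.ibp]; exact Finset.sum_nonneg fun b _ => mul_nonneg (hK a b) (hp b)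

lemma IsGF.dom {K K' : σ → σ → ℝ} {E E' : MvPolynomial σ ℝ →ₗ[ℝ] ℝ} (h : IsGF K E)
    (h' : IsGF K' E') (hK : ∀ a b, |K a b| ≤ K' a b) (p : MvPolynomial σ ℝ) (hp : NN p) :
    |E p| ≤ E' p := by
  refine NN.induction (fun p => |E p| ≤ E' p) ?_ ?_ ?_ p hp
  · intro c hc; simp [h.C, h'.C, abs_of_nonneg hc]
  · intro p q _ _ h1 h2; rw [map_add, map_add]; exact (abs_add_le _ _).trans (add_le_add h1 h2)
  · intro a p _ hp; rw [h.ibp, h'.ibp]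
    refine (Finset.abs_sum_le_sum_abs _ _).trans (Finset.sum_le_sum fun b _ => ?_)
    rw [abs_mul]
    exact mul_le_mul (hK a b) (hp b) (abs_nonneg _) ((abs_nonneg _).trans (hK a b))

lemma IsGF.dom_sub {K K' K0 : σ → σ → ℝ} {E E' E0 : MvPolynomial σ ℝ →ₗ[ℝ] ℝ} (h : IsGF K E)
    (h' : IsGF K' E') (h0 : IsGF K0 E0) (hK : ∀ a b, |K a b| ≤ K' a b)
    (hK0 : ∀ a b, 0 ≤ K0 a b) (hK' : ∀ a b, |K a b - K0 a b| ≤ K' a b - K0 a b)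
    (p : MvPolynomial σ ℝ) (hp : NN p) :
    |E p - E0 p| ≤ E' p - E0 p := by
  refine NN.induction (fun p => |E p - E0 p| ≤ E' p - E0 p) ?_ ?_ ?_ p hp
  · intro c hc; simp [h.C, h'.C, h0.C]
  · intro p q _ _ h1 h2; simp only [map_add]
    rw [show E p + E q - (E0 p + E0 q) = (E p - E0 p) + (E q - E0 q) by ring]
    refine (abs_add_le _ _).trans ?_
    linarith
  · intro a p hp hp'; rw [h.ibp, h'.ibp, h0.ibp, ← Finset.sum_sub_distrib, ← Finset.sum_sub_distrib]
    refine (Finset.abs_sum_le_sum_abs _ _).trans (Finset.sum_le_sum fun b _ => ?_)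
    have e1 := h.dom h' hK _ (hp.pderiv b)
    have e2 := hp' b
    calc |K a b * E (MvPolynomial.pderiv b p) - K0 a b * E0 (MvPolynomial.pderiv b p)|
        = |(K a b - K0 a b) * E (MvPolynomial.pderiv b p)
            + K0 a b * (E (MvPolynomial.pderiv b p) - E0 (MvPolynomial.pderiv b p))| := by
          congr 1; ring
      _ ≤ |(K a b - K0 a b)| * |E (MvPolynomial.pderiv b p)|
            + K0 a b * |(E (MvPolynomial.pderiv b p) - E0 (MvPolynomial.pderiv b p))| := by
          refine (abs_add_le _ _).trans ?_
          rw [abs_mul, abs_mul, abs_of_nonneg (hK0 a b)]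
      _ ≤ (K' a b - K0 a b) * E' (MvPolynomial.pderiv b p)
            + K0 a b * (E' (MvPolynomial.pderiv b p) - E0 (MvPolynomial.pderiv b p)) := by
          refine add_le_add (mul_le_mul (hK' a b) e1 (abs_nonneg _) ((abs_nonneg _).trans (hK' a b)))
            (mul_le_mul_of_nonneg_left e2 (hK0 a b))
      _ = _ := by ring

lemma IsGF.cov_step {K : σ → σ → ℝ} {E : MvPolynomial σ ℝ →ₗ[ℝ] ℝ} (h : IsGF K E)
    (a : σ) (p q : MvPolynomial σ ℝ) :
    E (X a * p * q) - E (X a * p) * E q =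
      ∑ b, K a b * ((E (pderiv b p * q) - E (pderiv b p) * E q) + E (p * pderiv b q)) := by
  rw [mul_assoc, h.ibp, h.ibp, Finset.sum_mul, ← Finset.sum_sub_distrib]
  refine Finset.sum_congr rfl fun b _ => ?_
  rw [pderiv_mul, map_add]; ring

lemma IsGF.cov_dom {K K' : σ → σ → ℝ} {E E' : MvPolynomial σ ℝ →ₗ[ℝ] ℝ} (h : IsGF K E)
    (h' : IsGF K' E') (hK : ∀ a b, |K a b| ≤ K' a b) (p q : MvPolynomial σ ℝ) (hp : NN p)
    (hq : NN q) :
    |E (p * q) - E p * E q| ≤ E' (p * q) - E' p * E' q := by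
  refine NN.induction (fun p => |E (p * q) - E p * E q| ≤ E' (p * q) - E' p * E' q) ?_ ?_ ?_ p hp
  · intro c hc; rw [h.C, h'.C, ← smul_eq_C_mul, map_smul, map_smul]; simp
  · intro p p' _ _ h1 h2
    simp only [add_mul, map_add]
    rw [show E (p * q) + E (p' * q) - (E p * E q + E p' * E q) =
      (E (p * q) - E p * E q) + (E (p' * q) - E p' * E q) by ring]
    refine (abs_add_le _ _).trans ?_
    linarith
  · intro a p hp hp'
    rw [h.cov_step, h'.cov_step]
    refine (Finset.abs_sum_le_sum_abs _ _).trans (Finset.sum_le_sum fun b _ => ?_)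
    rw [abs_mul]
    refine mul_le_mul (hK a b) ((abs_add_le _ _).trans (add_le_add (hp' b) ?_)) (abs_nonneg _)
      ((abs_nonneg _).trans (hK a b))
    exact h.dom h' hK _ (hp.mul (hq.pderiv b))

lemma IsGF.cov_nonneg {K : σ → σ → ℝ} {E : MvPolynomial σ ℝ →ₗ[ℝ] ℝ} (h : IsGF K E)
    (hK : ∀ a b, 0 ≤ K a b) (p q : MvPolynomial σ ℝ) (hp : NN p) (hq : NN q) :
    E p * E q ≤ E (p * q) := by
  have := (abs_nonneg _).trans (h.cov_dom h (fun a b => (abs_of_nonneg (hK a b)).le) p q hp hq)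
  linarith

lemma IsGF.cov_le {K : σ → σ → ℝ} {E : MvPolynomial σ ℝ →ₗ[ℝ] ℝ} (h : IsGF K E)
    (hK : ∀ a b, 0 ≤ K a b) (p q : MvPolynomial σ ℝ) (hp : NN p) (hq : NN q) :
    E (p * q) - E p * E q ≤ ∑ c, ∑ d, K c d * E (pderiv c p * pderiv d q) := by
  classical
  refine NN.induction (fun p => E (p * q) - E p * E q ≤
    ∑ c, ∑ d, K c d * E (pderiv c p * pderiv d q)) ?_ ?_ ?_ p hp
  · intro c hc; rw [h.C, ← smul_eq_C_mul, map_smul]; simp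
  · intro p p' _ _ h1 h2
    simp only [add_mul, map_add, mul_add, Finset.sum_add_distrib]
    linarith
  · intro a p hp hp'
    rw [h.cov_step]
    have e1 : ∀ c d, E (pderiv c (X a * p) * pderiv d q) =
        (if a = c then E (p * pderiv d q) else 0) +
        ∑ b, K a b * (E (pderiv c (pderiv b p) * pderiv d q)
          + E (pderiv c p * pderiv b (pderiv d q))) := by
      intro c d
      rw [pderiv_mul, add_mul, map_add]
      congr 1
      · rw [pderiv_X]
        by_cases hac : a = c
        · subst hac; simp
        · simp [hac]
      · rw [mul_assoc, h.ibp]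
        refine Finset.sum_congr rfl fun b _ => ?_
        rw [pderiv_mul, map_add, pderiv_comm b c]
    have e2 : ∀ c d, (if a = c then K c d * E (p * pderiv d q) else 0) +
        ∑ b, K a b * (K c d * E (pderiv c (pderiv b p) * pderiv d q)) ≤
        K c d * E (pderiv c (X a * p) * pderiv d q) := by
      intro c d
      rw [e1, mul_add, mul_ite, mul_zero, Finset.mul_sum]
      refine add_le_add le_rfl (Finset.sum_le_sum fun b _ => ?_)
      have := h.nonneg hK _ ((hp.pderiv c).mul ((hq.pderiv d).pderiv b))
      have := mul_nonneg (mul_nonneg (hK a b) (hK c d)) this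
      linarith
    have e3 := Finset.sum_le_sum fun c (_ : c ∈ Finset.univ) =>
      Finset.sum_le_sum fun d (_ : d ∈ Finset.univ) => e2 c d
    refine le_trans ?_ e3
    simp only [Finset.sum_add_distrib, mul_add]
    rw [add_comm]
    refine add_le_add ?_ ?_
    · rw [Finset.sum_comm (s := Finset.univ) (t := Finset.univ)]
      simp
    · have : ∑ c, ∑ d, ∑ b, K a b * (K c d * E (pderiv c (pderiv b p) * pderiv d q)) =
        ∑ b, K a b * ∑ c, ∑ d, (K c d * E (pderiv c (pderiv b p) * pderiv d q)) := by
        simp only [Finset.mul_sum]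
        rw [Finset.sum_comm]
        conv_rhs => rw [Finset.sum_comm]
        rw [Finset.sum_comm]
        refine Finset.sum_congr rfl fun b _ => ?_
        rw [Finset.sum_comm]
      rw [this]
      exact Finset.sum_le_sum fun b _ => mul_le_mul_of_nonneg_left (hp' b) (hK a b)

end Fun
end GM


namespace GM
open MvPolynomial
section Exist
variable {σ : Type*} [Fintype σ]

lemma IsGF.unique {K : σ → σ → ℝ} {E E' : MvPolynomial σ ℝ →ₗ[ℝ] ℝ} (h : IsGF K E)
    (h' : IsGF K E') (p : MvPolynomial σ ℝ) (hp : NN p) : E p = E' p := by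
  refine NN.induction (fun p => E p = E' p) ?_ ?_ ?_ p hp
  · intro c _; rw [h.C, h'.C]
  · intro p q _ _ h1 h2; rw [map_add, map_add, h1, h2]
  · intro a p _ hp; rw [h.ibp, h'.ibp]; exact Finset.sum_congr rfl fun b _ => by rw [hp b]

/-- First-order operator attached to the row `a` of the kernel. -/
noncomputable def dK (K : σ → σ → ℝ) (a : σ) : MvPolynomial σ ℝ →ₗ[ℝ] MvPolynomial σ ℝ :=
  ∑ b, K a b • (pderiv b).toLinearMap

/-- Laplace operator attached to the kernel. -/
noncomputable def lapK (K : σ → σ → ℝ) : MvPolynomial σ ℝ →ₗ[ℝ] MvPolynomial σ ℝ :=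
  ∑ a, (pderiv a).toLinearMap ∘ₗ dK K a

lemma dK_apply (K : σ → σ → ℝ) (a : σ) (p : MvPolynomial σ ℝ) :
    dK K a p = ∑ b, K a b • pderiv b p := by simp [dK]

lemma lapK_apply (K : σ → σ → ℝ) (p : MvPolynomial σ ℝ) :
    lapK K p = ∑ a, ∑ b, K a b • pderiv a (pderiv b p) := by simp [lapK, dK_apply]

lemma lapK_X_mul (K : σ → σ → ℝ) (hK : ∀ a b, K a b = K b a) (a : σ) (g : MvPolynomial σ ℝ) :
    lapK K (X a * g) = X a * lapK K g + (2 : ℝ) • dK K a g := by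
  classical
  simp only [lapK_apply, dK_apply, pderiv_mul, pderiv_X, map_add]
  have : ∀ x b, (pderiv x) (Pi.single (M := fun _ => MvPolynomial σ ℝ) b 1 a) = 0 := by
    intro x b
    by_cases h : a = b
    · subst h; simp
    · simp [h]
  simp only [this, zero_mul, zero_add, smul_add, Finset.sum_add_distrib]
  have e1 : ∑ x, ∑ b, K x b • (Pi.single (M := fun _ => MvPolynomial σ ℝ) b 1 a * pderiv x g)
      = ∑ b, K a b • pderiv b g := by
    refine Finset.sum_congr rfl fun x _ => ?_
    rw [Finset.sum_eq_single a]
    · simp [hK a x]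
    · intro b _ hb; simp [hb.symm]
    · simp
  have e2 : ∑ x, ∑ b, K x b • (Pi.single (M := fun _ => MvPolynomial σ ℝ) x 1 a * pderiv b g)
      = ∑ b, K a b • pderiv b g := by
    rw [Finset.sum_eq_single a]
    · simp
    · intro b _ hb; simp [hb.symm]
    · simp
  rw [e1, e2, Finset.mul_sum]
  simp only [Finset.mul_sum, mul_smul_comm]
  rw [two_smul]; ring

lemma lapK_dK (K : σ → σ → ℝ) (a : σ) (g : MvPolynomial σ ℝ) :
    lapK K (dK K a g) = dK K a (lapK K g) := by
  have h : ∀ c, lapK K (pderiv c g) = pderiv c (lapK K g) := by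
    intro c
    simp only [lapK_apply, map_sum, Derivation.map_smul]
    refine Finset.sum_congr rfl fun x _ => Finset.sum_congr rfl fun y _ => ?_
    rw [pderiv_comm c x, pderiv_comm c y]
  rw [dK_apply, dK_apply, map_sum]
  refine Finset.sum_congr rfl fun x _ => ?_
  rw [map_smul, h]

lemma lapK_pow_X_mul (K : σ → σ → ℝ) (hK : ∀ a b, K a b = K b a) (a : σ) (g : MvPolynomial σ ℝ)
    (k : ℕ) : (lapK K ^ (k+1)) (X a * g) =
      X a * (lapK K ^ (k+1)) g + (2 * (k+1) : ℝ) • (lapK K ^ k) (dK K a g) := by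
  induction k with
  | zero => simp [lapK_X_mul K hK]
  | succ k ih =>
    have hc : ∀ j, lapK K ((lapK K ^ j) (dK K a g)) = (lapK K ^ (j+1)) (dK K a g) := by
      intro j; rw [pow_succ']; rfl
    have hd : ∀ j, dK K a ((lapK K ^ j) g) = (lapK K ^ j) (dK K a g) := by
      intro j
      induction j with
      | zero => simp
      | succ j ihj => rw [← hc, ← ihj, lapK_dK, pow_succ']; rfl
    rw [pow_succ', Module.End.mul_apply, ih, map_add, map_smul, lapK_X_mul K hK, hd, hc,
      Module.End.mul_apply, add_assoc, ← add_smul]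
    push_cast
    congr 2; ring

lemma lapK_deg (K : σ → σ → ℝ) (p : MvPolynomial σ ℝ) :
    (lapK K p).totalDegree ≤ p.totalDegree - 1 := by
  rw [lapK_apply]
  refine totalDegree_finsetSum_le fun a _ => totalDegree_finsetSum_le fun b _ => ?_
  refine (totalDegree_smul_le _ _).trans ((totalDegree_pderiv_le _ _).trans ?_)
  have := totalDegree_pderiv_le p b
  omega

lemma lapK_C (K : σ → σ → ℝ) (c : ℝ) : lapK K (MvPolynomial.C c) = 0 := by
  simp [lapK_apply]

lemma lapK_pow_eq_zero (K : σ → σ → ℝ) (d : ℕ) : ∀ p : MvPolynomial σ ℝ, p.totalDegree ≤ d →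
    ∀ k, d < k → (lapK K ^ k) p = 0 := by
  induction d with
  | zero =>
    intro p hp k hk
    obtain ⟨k, rfl⟩ : ∃ j, k = j + 1 := ⟨k - 1, by omega⟩
    rw [(totalDegree_eq_zero_iff_eq_C).mp (by omega : p.totalDegree = 0), pow_succ,
      Module.End.mul_apply, lapK_C, map_zero]
  | succ d ih =>
    intro p hp k hk
    obtain ⟨k, rfl⟩ : ∃ j, k = j + 1 := ⟨k - 1, by omega⟩
    rw [pow_succ, Module.End.mul_apply]
    refine ih _ ((lapK_deg K p).trans (by omega)) k (by omega)

/-- Truncated Gaussian expectation. -/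
noncomputable def trE (K : σ → σ → ℝ) (N : ℕ) (p : MvPolynomial σ ℝ) : ℝ :=
  ∑ k ∈ Finset.range N, (1 / (2 ^ k * k.factorial : ℝ)) * constantCoeff ((lapK K ^ k) p)

lemma trE_eq (K : σ → σ → ℝ) (p : MvPolynomial σ ℝ) (N : ℕ) (h : p.totalDegree + 1 ≤ N) :
    trE K (p.totalDegree + 1) p = trE K N p := by
  refine Finset.sum_subset (by simpa using h) fun k _ hk => ?_
  rw [lapK_pow_eq_zero K _ p le_rfl k (by simpa using hk)]; simp

lemma exists_isGF (K : σ → σ → ℝ) (hK : ∀ a b, K a b = K b a) :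
    ∃ E : MvPolynomial σ ℝ →ₗ[ℝ] ℝ, IsGF K E := by
  let E : MvPolynomial σ ℝ →ₗ[ℝ] ℝ :=
    { toFun := fun p => trE K (p.totalDegree + 1) p
      map_add' := by
        intro p q
        let N := p.totalDegree + q.totalDegree + (p+q).totalDegree + 1
        rw [trE_eq K p N (by omega), trE_eq K q N (by omega), trE_eq K (p+q) N (by omega)]
        simp [trE, mul_add, Finset.sum_add_distrib]
      map_smul' := by
        intro c p
        let N := p.totalDegree + (c • p).totalDegree + 1
        rw [trE_eq K p N (by omega), trE_eq K _ N (by omega)]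
        simp only [trE, map_smul, RingHom.id_apply, smul_eq_mul, Finset.mul_sum, constantCoeff_smul]
        exact Finset.sum_congr rfl fun k _ => by ring }
  have hE : ∀ p N, p.totalDegree + 1 ≤ N → E p = trE K N p := fun p N h => trE_eq K p N h
  refine ⟨E, ?_, ?_⟩
  · rw [hE 1 1 (by simp)]; simp [trE]
  · intro a g
    have e : ∑ b, K a b * E (pderiv b g) = E (dK K a g) := by
      simp [dK_apply]
    rw [e]
    let N := (X a * g).totalDegree + (dK K a g).totalDegree + 1
    rw [hE _ (N+1) (by omega), hE (dK K a g) N (by omega), trE, trE, Finset.sum_range_succ']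
    simp only [lapK_pow_X_mul K hK]
    simp only [map_add, map_mul, constantCoeff_X, zero_mul, zero_add, constantCoeff_smul,
      smul_eq_mul, pow_zero, Module.End.one_apply, mul_zero, add_zero]
    refine Finset.sum_congr rfl fun k _ => ?_
    rw [Nat.factorial_succ, pow_succ]
    push_cast
    have : ((k:ℝ) + 1) ≠ 0 := by positivity
    field_simp

end Exist
end GM


namespace GM
open MvPolynomial
section Mat
variable {ι : Type*} [Fintype ι] [DecidableEq ι]

variable (ι) in
/-- Generic matrix. -/
noncomputable def Mg : Matrix ι ι (MvPolynomial (ι × ι) ℝ) := Matrix.of fun i j => X (i, j)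

variable (ι) in
/-- Trace of powers of the generic matrix. -/
noncomputable def TT (m : ℕ) : MvPolynomial (ι × ι) ℝ := ∑ i, ((Mg ι) ^ m) i i

variable (ι) in
/-- Sum of all entries of powers of the generic matrix. -/
noncomputable def SS (m : ℕ) : MvPolynomial (ι × ι) ℝ := ∑ a : ι × ι, ((Mg ι) ^ m) a.1 a.2

variable (ι) in
/-- Entrywise product of two powers of the generic matrix. -/
noncomputable def DD (r s : ℕ) : MvPolynomial (ι × ι) ℝ :=
  ∑ a : ι × ι, ((Mg ι) ^ r) a.1 a.2 * ((Mg ι) ^ s) a.1 a.2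

lemma Mg_pow_nn (m : ℕ) : ∀ i j, NN ((Mg ι ^ m) i j) := by
  induction m with
  | zero =>
    intro i j
    rw [pow_zero, Matrix.one_apply]
    split_ifs
    · exact NN.one
    · exact NN.zero
  | succ m ih =>
    intro i j
    rw [pow_succ', Matrix.mul_apply]
    exact NN.sum _ fun k _ => (NN.X _).mul (ih _ _)

lemma TT_nn (m : ℕ) : NN (TT ι m) := NN.sum _ fun _ _ => Mg_pow_nn _ _ _

lemma TT_zero : TT ι 0 = MvPolynomial.C (Fintype.card ι : ℝ) := by simp [TT]

lemma pderiv_Mg_pow (k l : ι) (m : ℕ) : ∀ i j, pderiv (k, l) ((Mg ι ^ (m + 1)) i j) =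
    ∑ p ∈ Finset.HasAntidiagonal.antidiagonal m, (Mg ι ^ p.1) i k * (Mg ι ^ p.2) l j := by
  induction m with
  | zero =>
    intro i j
    simp [Mg, Matrix.one_apply, Pi.single_apply, pderiv_X]
    by_cases h1 : i = k <;> by_cases h2 : l = j <;> simp [h1, h2, eq_comm]
  | succ m ih =>
    intro i j
    rw [pow_succ', Matrix.mul_apply, map_sum, Finset.Nat.sum_antidiagonal_succ]
    simp only [pderiv_mul, ih, Finset.sum_add_distrib]
    congr 1
    · simp only [Mg, Matrix.of_apply, pderiv_X, pow_zero, Matrix.one_apply, Pi.single_apply,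
        Prod.mk.injEq]
      rw [Finset.sum_eq_single l]
      · simp
      · intro b _ hb; simp [hb]
      · simp
    · simp only [Finset.mul_sum]
      rw [Finset.sum_comm]
      refine Finset.sum_congr rfl fun p _ => ?_
      rw [pow_succ', Matrix.mul_apply, Finset.sum_mul]
      exact Finset.sum_congr rfl fun x _ => by ring

lemma pderiv_TT (k l : ι) (m : ℕ) :
    pderiv (k, l) (TT ι (m + 1)) = (m + 1 : ℝ) • (Mg ι ^ m) l k := by
  rw [TT, map_sum]
  simp only [pderiv_Mg_pow]
  rw [Finset.sum_comm]
  have : ∀ p ∈ Finset.HasAntidiagonal.antidiagonal m,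
      ∑ i, (Mg ι ^ p.1) i k * (Mg ι ^ p.2) l i = (Mg ι ^ m) l k := by
    intro p hp
    rw [Finset.HasAntidiagonal.mem_antidiagonal] at hp
    rw [← hp, add_comm, pow_add, Matrix.mul_apply]
    exact Finset.sum_congr rfl fun x _ => by ring
  rw [Finset.sum_congr rfl this]
  simp [← Nat.cast_smul_eq_nsmul ℝ]

/-- The comparison kernel. -/
noncomputable def KK (α α' β : ℝ) (a b : ι × ι) : ℝ :=
  α * (if b = (a.2, a.1) then 1 else 0) + α' * (if b = a then 1 else 0) + β

lemma KK_symm (α α' β : ℝ) (a b : ι × ι) : KK α α' β a b = KK α α' β b a := by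
  unfold KK
  have h1 : (b = (a.2, a.1)) ↔ (a = (b.2, b.1)) := by
    constructor <;> (intro h; rw [h])
  have h2 : (b = a) ↔ (a = b) := eq_comm
  simp only [h1, h2]

lemma KK_nonneg {α α' β : ℝ} (h1 : 0 ≤ α) (h2 : 0 ≤ α') (h3 : 0 ≤ β) (a b : ι × ι) :
    0 ≤ KK α α' β a b := by
  unfold KK
  split_ifs <;> simp <;> linarith

lemma KK_sum (α α' β : ℝ) (f : ι × ι → ι × ι → ℝ) :
    ∑ a, ∑ b, KK α α' β a b * f a b =
      α * ∑ a, f a (a.2, a.1) + α' * ∑ a, f a a + β * ∑ a, ∑ b, f a b := by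
  simp only [KK, add_mul, Finset.sum_add_distrib, Finset.mul_sum]
  congr 1
  congr 1
  · refine Finset.sum_congr rfl fun a _ => ?_
    simp
  · refine Finset.sum_congr rfl fun a _ => ?_
    simp

lemma TT_succ (m : ℕ) : TT ι (m + 1) = ∑ a : ι × ι, X a * (Mg ι ^ m) a.2 a.1 := by
  rw [TT, Fintype.sum_prod_type]
  refine Finset.sum_congr rfl fun i _ => ?_
  rw [pow_succ', Matrix.mul_apply]; rfl

lemma sd {α α' β : ℝ} {E : MvPolynomial (ι × ι) ℝ →ₗ[ℝ] ℝ} (h : IsGF (KK α α' β) E) (m : ℕ) :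
    E (TT ι (m + 2)) = ∑ p ∈ Finset.HasAntidiagonal.antidiagonal m,
      (α * E (TT ι p.1 * TT ι p.2) + α' * E (DD ι p.1 p.2) + β * E (SS ι p.1 * SS ι p.2)) := by
  rw [TT_succ, map_sum]
  simp only [h.ibp]
  have : ∀ a b : ι × ι, pderiv b ((Mg ι ^ (m+1)) a.2 a.1) =
    ∑ p ∈ Finset.HasAntidiagonal.antidiagonal m, (Mg ι ^ p.1) a.2 b.1 * (Mg ι ^ p.2) b.2 a.1 := by
    intro a b; exact pderiv_Mg_pow b.1 b.2 m _ _
  simp only [this]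
  rw [KK_sum]
  simp only [map_sum]
  simp only [Finset.sum_add_distrib, ← Finset.mul_sum]
  congr 1
  · congr 1
    · congr 1
      rw [Finset.sum_comm]
      refine Finset.sum_congr rfl fun p _ => ?_
      rw [← map_sum, TT, TT, Finset.sum_mul_sum, Fintype.sum_prod_type, Finset.sum_comm]
    · congr 1
      rw [Finset.sum_comm]
      refine Finset.sum_congr rfl fun p _ => ?_
      rw [← map_sum, DD]
      congr 1
      rw [Fintype.sum_prod_type, Fintype.sum_prod_type, Finset.sum_comm]
  · congr 1
    have : ∀ a : ι × ι, ∑ b : ι × ι, ∑ p ∈ Finset.HasAntidiagonal.antidiagonal m,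
      E ((Mg ι ^ p.1) a.2 b.1 * (Mg ι ^ p.2) b.2 a.1) = ∑ p ∈ Finset.HasAntidiagonal.antidiagonal m,
        ∑ b : ι × ι, E ((Mg ι ^ p.1) a.2 b.1 * (Mg ι ^ p.2) b.2 a.1) :=
      fun a => Finset.sum_comm
    simp only [this]
    rw [Finset.sum_comm]
    refine Finset.sum_congr rfl fun p _ => ?_
    simp only [← map_sum]
    congr 1
    simp only [SS, Finset.sum_mul_sum, Fintype.sum_prod_type]
    rw [Finset.sum_comm]
    refine Finset.sum_congr rfl fun i _ => ?_
    rw [Finset.sum_comm]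
    conv_rhs => rw [Finset.sum_comm]
    refine Finset.sum_congr rfl fun j _ => ?_
    rw [Finset.sum_comm]

lemma covT {α α' β : ℝ} (h1 : 0 ≤ α) (h2 : 0 ≤ α') (h3 : 0 ≤ β)
    {E : MvPolynomial (ι × ι) ℝ →ₗ[ℝ] ℝ} (h : IsGF (KK α α' β) E) (r s : ℕ) :
    E (TT ι (r+1) * TT ι (s+1)) - E (TT ι (r+1)) * E (TT ι (s+1)) ≤
      (r+1) * (s+1) * (α * E (TT ι (r+s)) + α' * E (DD ι r s) + β * E (SS ι r * SS ι s)) := by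
  refine (h.cov_le (KK_nonneg h1 h2 h3) _ _ (TT_nn _) (TT_nn _)).trans (le_of_eq ?_)
  have : ∀ c d : ι × ι, E (pderiv c (TT ι (r+1)) * pderiv d (TT ι (s+1))) =
      (r+1) * (s+1) * E ((Mg ι ^ r) c.2 c.1 * (Mg ι ^ s) d.2 d.1) := by
    intro c d
    have e1 := pderiv_TT c.1 c.2 r
    have e2 := pderiv_TT d.1 d.2 s
    simp only [Prod.mk.eta] at e1 e2
    rw [e1, e2, smul_mul_smul_comm, map_smul, smul_eq_mul]
  simp only [this]
  rw [KK_sum]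
  simp only [← Finset.mul_sum, ← map_sum]
  have e1 : ∑ a : ι × ι, (Mg ι ^ r) a.2 a.1 * (Mg ι ^ s) a.1 a.2 = TT ι (r+s) := by
    rw [TT, pow_add, Fintype.sum_prod_type, Finset.sum_comm]
    refine Finset.sum_congr rfl fun i _ => ?_
    rw [Matrix.mul_apply]
  have e2 : ∑ a : ι × ι, (Mg ι ^ r) a.2 a.1 * (Mg ι ^ s) a.2 a.1 = DD ι r s := by
    rw [DD, Fintype.sum_prod_type, Fintype.sum_prod_type, Finset.sum_comm]
  have e3 : ∑ a : ι × ι, (Mg ι ^ r) a.2 a.1 * ∑ b : ι × ι, (Mg ι ^ s) b.2 b.1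
      = SS ι r * SS ι s := by
    have : ∀ m, SS ι m = ∑ b : ι × ι, (Mg ι ^ m) b.2 b.1 := by
      intro m
      rw [SS, Fintype.sum_prod_type, Fintype.sum_prod_type, Finset.sum_comm]
    rw [← Finset.sum_mul, ← this, ← this]
  rw [e1, e2, e3]; ring

lemma sum_antidiag_even_le (f : ℕ → ℝ) (hf : ∀ r, 0 ≤ f r) (k : ℕ) :
    ∑ p ∈ Finset.HasAntidiagonal.antidiagonal k, f (2 * p.1) * f (2 * p.2) ≤
      ∑ p ∈ Finset.HasAntidiagonal.antidiagonal (2 * k), f p.1 * f p.2 := by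
  classical
  rw [← Finset.sum_image (g := fun p : ℕ × ℕ => (2 * p.1, 2 * p.2))
    (f := fun p : ℕ × ℕ => f p.1 * f p.2)]
  · refine Finset.sum_le_sum_of_subset_of_nonneg ?_ fun p _ _ => mul_nonneg (hf _) (hf _)
    intro p hp
    simp only [Finset.mem_image, Finset.HasAntidiagonal.mem_antidiagonal] at hp ⊢
    obtain ⟨q, hq, rfl⟩ := hp
    simp; omega
  · intro p _ q _ h
    simp at h
    exact Prod.ext h.1 h.2

lemma sum_antidiag_even_eq (f : ℕ → ℝ) (hf : ∀ r, Odd r → f r = 0) (k : ℕ) :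
    ∑ p ∈ Finset.HasAntidiagonal.antidiagonal k, f (2 * p.1) * f (2 * p.2) =
      ∑ p ∈ Finset.HasAntidiagonal.antidiagonal (2 * k), f p.1 * f p.2 := by
  classical
  rw [← Finset.sum_image (g := fun p : ℕ × ℕ => (2 * p.1, 2 * p.2))
    (f := fun p : ℕ × ℕ => f p.1 * f p.2)]
  · refine Finset.sum_subset ?_ ?_
    · intro p hp
      simp only [Finset.mem_image, Finset.HasAntidiagonal.mem_antidiagonal] at hp ⊢
      obtain ⟨q, hq, rfl⟩ := hp
      simp; omega
    · intro p hp hp'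
      rcases Nat.even_or_odd p.1 with he | ho
      · exfalso
        apply hp'
        obtain ⟨a, ha⟩ := he
        simp only [Finset.mem_image, Finset.HasAntidiagonal.mem_antidiagonal] at hp ⊢
        exact ⟨(a, k - a), by simp; omega, Prod.ext (by simp; omega) (by simp; omega)⟩
      · rw [hf _ ho, zero_mul]
  · intro p _ q _ h
    simp at h
    exact Prod.ext h.1 h.2

lemma lowerW {E : MvPolynomial (ι × ι) ℝ →ₗ[ℝ] ℝ} (h : IsGF (KK 1 0 0) E) (k : ℕ) :
    (Fintype.card ι : ℝ) ^ (k + 1) * catalan k ≤ E (TT ι (2 * k)) := by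
  have hK := KK_nonneg (ι := ι) (α := 1) (α' := 0) (β := 0) (by simp) le_rfl le_rfl
  induction k using Nat.strong_induction_on with
  | _ k ih =>
  rcases k with _ | k
  · rw [mul_zero, TT_zero, h.C]; simp
  · rw [show 2 * (k+1) = 2 * k + 2 by ring, sd h]
    simp only [one_mul, zero_mul, add_zero]
    calc (Fintype.card ι : ℝ) ^ (k + 1 + 1) * catalan (k+1)
        = ∑ p ∈ Finset.HasAntidiagonal.antidiagonal k, ((Fintype.card ι : ℝ) ^ (p.1 + 1) * catalan p.1)
            * ((Fintype.card ι : ℝ) ^ (p.2 + 1) * catalan p.2) := by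
          rw [catalan_succ']
          push_cast
          rw [Finset.mul_sum]
          refine Finset.sum_congr rfl fun p hp => ?_
          rw [Finset.HasAntidiagonal.mem_antidiagonal] at hp
          rw [← hp]; ring
      _ ≤ ∑ p ∈ Finset.HasAntidiagonal.antidiagonal k, E (TT ι (2 * p.1)) * E (TT ι (2 * p.2)) := by
          refine Finset.sum_le_sum fun p hp => ?_
          rw [Finset.HasAntidiagonal.mem_antidiagonal] at hp
          exact mul_le_mul (ih _ (by omega)) (ih _ (by omega)) (by positivity)
            (h.nonneg hK _ (TT_nn _))
      _ ≤ ∑ p ∈ Finset.HasAntidiagonal.antidiagonal (2 * k), E (TT ι p.1) * E (TT ι p.2) :=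
          sum_antidiag_even_le (fun r => E (TT ι r)) (fun r => h.nonneg hK _ (TT_nn _)) k
      _ ≤ _ := Finset.sum_le_sum fun p _ => h.cov_nonneg hK _ _ (TT_nn _) (TT_nn _)

/-- Properties of a genuine Gaussian expectation of a symmetric matrix. -/
structure PosY (E : MvPolynomial (ι × ι) ℝ →ₗ[ℝ] ℝ) : Prop where
  hD : ∀ r s, E (DD ι r s) = E (TT ι (r + s))
  hS : ∀ r s, Even (r + s) → E (SS ι r * SS ι s) ≤ (Fintype.card ι : ℝ) ^ 2 * E (TT ι (r + s))
  hodd : ∀ r, Odd r → E (TT ι r) = 0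

lemma catalan_mono (k : ℕ) : catalan k ≤ catalan (k + 1) := by
  rw [catalan_succ']
  have := Finset.single_le_sum (f := fun p : ℕ × ℕ => catalan p.1 * catalan p.2)
    (fun _ _ => Nat.zero_le _) (show (k, 0) ∈ Finset.HasAntidiagonal.antidiagonal k by simp)
  simpa using this

lemma covY {α β : ℝ} (h1 : 0 ≤ α) (h3 : 0 ≤ β)
    {E : MvPolynomial (ι × ι) ℝ →ₗ[ℝ] ℝ} (h : IsGF (KK α α β) E) (hY : PosY E) (r s : ℕ)
    (hrs : Even (r + s)) :
    E (TT ι (r+1) * TT ι (s+1)) ≤ E (TT ι (r+1)) * E (TT ι (s+1)) +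
      (r+1) * (s+1) * ((2 * α + β * (Fintype.card ι : ℝ) ^ 2) * E (TT ι (r+s))) := by
  have e := covT h1 h1 h3 h r s
  rw [hY.hD] at e
  have e2 := mul_le_mul_of_nonneg_left (hY.hS r s hrs) h3
  have e3 := mul_le_mul_of_nonneg_left e2 (by positivity : (0:ℝ) ≤ (r+1) * (s+1))
  linarith

lemma recY {α β : ℝ} (h1 : 0 ≤ α) (h3 : 0 ≤ β)
    {E : MvPolynomial (ι × ι) ℝ →ₗ[ℝ] ℝ} (h : IsGF (KK α α β) E) (hY : PosY E) (k : ℕ) :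
    E (TT ι (2 * (k + 1))) ≤ α * ∑ p ∈ Finset.HasAntidiagonal.antidiagonal k, E (TT ι (2 * p.1)) * E (TT ι (2 * p.2))
      + (α + β * (Fintype.card ι : ℝ) ^ 2) * (2 * k + 1) * E (TT ι (2 * k))
      + α * ((2 * k + 1) * (2 * k) ^ 2 * (2 * α + β * (Fintype.card ι : ℝ) ^ 2)
        * E (TT ι (2 * (k - 1)))) := by
  have hK := KK_nonneg (ι := ι) h1 h1 h3
  set N : ℝ := (Fintype.card ι : ℝ) ^ 2 with hN
  have hN0 : 0 ≤ N := by positivity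
  have hT : ∀ r, 0 ≤ E (TT ι r) := fun r => h.nonneg hK _ (TT_nn _)
  rw [show 2 * (k+1) = 2 * k + 2 by ring, sd h]
  have key : ∀ p ∈ Finset.HasAntidiagonal.antidiagonal (2 * k),
      (α * E (TT ι p.1 * TT ι p.2) + α * E (DD ι p.1 p.2) + β * E (SS ι p.1 * SS ι p.2)) ≤
      α * (E (TT ι p.1) * E (TT ι p.2)) + (α + β * N) * E (TT ι (2 * k))
      + α * ((2 * k) ^ 2 * (2 * α + β * N) * E (TT ι (2 * (k - 1)))) := by
    rintro ⟨r, s⟩ hp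
    simp only [Finset.HasAntidiagonal.mem_antidiagonal] at hp
    have hSS := mul_le_mul_of_nonneg_left (hY.hS r s (by rw [hp]; simp)) h3
    have hDD := hY.hD r s
    rw [hp] at hSS hDD
    simp only
    rw [hDD]
    have hc : E (TT ι r * TT ι s) ≤ E (TT ι r) * E (TT ι s) +
        (2 * k) ^ 2 * (2 * α + β * N) * E (TT ι (2 * (k - 1))) := by
      have hpos : 0 ≤ (2 * α + β * N) * E (TT ι (2 * (k - 1))) :=
        mul_nonneg (by positivity) (hT _)
      rcases r with _ | r
      · rw [TT_zero, h.C, ← smul_eq_C_mul, map_smul, smul_eq_mul]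
        have : 0 ≤ (2 * (k:ℝ)) ^ 2 * ((2 * α + β * N) * E (TT ι (2 * (k - 1)))) := by positivity
        linarith
      rcases s with _ | s
      · rw [TT_zero, h.C, mul_comm, ← smul_eq_C_mul, map_smul, smul_eq_mul]
        have : 0 ≤ (2 * (k:ℝ)) ^ 2 * ((2 * α + β * N) * E (TT ι (2 * (k - 1)))) := by positivity
        linarith
      have hrs : r + s = 2 * (k - 1) := by omega
      have := covY h1 h3 h hY r s (by rw [hrs]; simp)
      rw [hrs] at this
      refine this.trans ?_
      have hr : (r:ℝ) + 1 ≤ 2 * k := by exact_mod_cast (by omega : r + 1 ≤ 2 * k)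
      have hs : (s:ℝ) + 1 ≤ 2 * k := by exact_mod_cast (by omega : s + 1 ≤ 2 * k)
      have : ((r:ℝ)+1) * (s+1) ≤ (2 * k) ^ 2 := by
        rw [sq]; exact mul_le_mul hr hs (by positivity) (by positivity)
      have := mul_le_mul_of_nonneg_right this hpos
      linarith
    have := mul_le_mul_of_nonneg_left hc h1
    linarith
  refine (Finset.sum_le_sum key).trans (le_of_eq ?_)
  rw [sum_antidiag_even_eq (fun r => E (TT ι r)) hY.hodd k]
  simp only [Finset.sum_add_distrib, Finset.sum_const, Finset.Nat.card_antidiagonal,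
    ← Finset.mul_sum, nsmul_eq_mul]
  push_cast
  ring

lemma upperY {α β : ℝ} (h1 : 0 ≤ α) (h3 : 0 ≤ β) (hι : 0 < Fintype.card ι)
    {E : MvPolynomial (ι × ι) ℝ →ₗ[ℝ] ℝ} (h : IsGF (KK α α β) E) (hY : PosY E) (L : ℕ) (ρ : ℝ)
    (hρ1 : 1 ≤ ρ) (hρ : α + (α + β * (Fintype.card ι : ℝ) ^ 2) * (2 * L) / (Fintype.card ι : ℝ)
      + α * ((2 * L) ^ 3 * (2 * α + β * (Fintype.card ι : ℝ) ^ 2)) / (Fintype.card ι : ℝ) ^ 2 ≤ ρ)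
    (k : ℕ) (hk : k ≤ L) :
    E (TT ι (2 * k)) ≤ (Fintype.card ι : ℝ) ^ (k + 1) * (ρ ^ k * catalan k) := by
  have hK := KK_nonneg (ι := ι) h1 h1 h3
  have hT : ∀ r, 0 ≤ E (TT ι r) := fun r => h.nonneg hK _ (TT_nn _)
  induction k using Nat.strong_induction_on with
  | _ k ih =>
  rcases k with _ | k
  · rw [mul_zero, TT_zero, h.C]; simp
  refine (recY h1 h3 h hY k).trans ?_
  set n : ℝ := (Fintype.card ι : ℝ) with hn
  have hn0 : 0 < n := by rw [hn]; exact_mod_cast hι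
  have hρ0 : 0 < ρ := by linarith
  set c : ℝ := (catalan (k+1) : ℝ) with hc
  have hc0 : 0 ≤ c := by positivity
  have hkL : (k:ℝ) + 1 ≤ L := by exact_mod_cast hk
  have A : ∑ p ∈ Finset.HasAntidiagonal.antidiagonal k, E (TT ι (2 * p.1)) * E (TT ι (2 * p.2)) ≤
      n ^ (k+2) * (ρ ^ k * c) := by
    calc _ ≤ ∑ p ∈ Finset.HasAntidiagonal.antidiagonal k, (n ^ (p.1 + 1) * (ρ ^ p.1 * catalan p.1)) *
            (n ^ (p.2 + 1) * (ρ ^ p.2 * catalan p.2)) := by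
          refine Finset.sum_le_sum fun p hp => ?_
          rw [Finset.HasAntidiagonal.mem_antidiagonal] at hp
          exact mul_le_mul (ih _ (by omega) (by omega)) (ih _ (by omega) (by omega)) (hT _)
            (by positivity)
      _ = _ := by
          rw [hc, catalan_succ']
          push_cast
          rw [Finset.mul_sum, Finset.mul_sum]
          refine Finset.sum_congr rfl fun p hp => ?_
          rw [Finset.HasAntidiagonal.mem_antidiagonal] at hp
          rw [← hp]; ring
  have B : E (TT ι (2 * k)) ≤ n ^ (k+1) * (ρ ^ k * c) := by
    refine (ih k (by omega) (by omega)).trans ?_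
    have : (catalan k : ℝ) ≤ c := by rw [hc]; exact_mod_cast catalan_mono k
    gcongr
  have B' : (2 * k + 1) * E (TT ι (2 * k)) ≤ (2 * L) * (n ^ (k+1) * (ρ ^ k * c)) :=
    mul_le_mul (by linarith) B (hT _) (by positivity)
  have D : ((2 * k + 1) * (2 * k) ^ 2) * E (TT ι (2 * (k - 1))) ≤
      (2 * L) ^ 3 * (n ^ k * (ρ ^ k * c)) := by
    rcases k with _ | k
    · simp; positivity
    · refine mul_le_mul ?_ ?_ (hT _) (by positivity)
      · have a1 : (2 * ((k+1 : ℕ):ℝ) + 1) ≤ 2 * L := by linarith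
        have a2 : (2 * ((k+1 : ℕ):ℝ)) ≤ 2 * L := by linarith
        calc _ ≤ (2 * (L:ℝ)) * (2 * L) ^ 2 := by gcongr
          _ = _ := by ring
      · refine (ih k (by omega) (by omega)).trans ?_
        have : (catalan k : ℝ) ≤ c := by
          rw [hc]; exact_mod_cast (catalan_mono k).trans (catalan_mono (k+1))
        have : ρ ^ k ≤ ρ ^ (k+1) := pow_le_pow_right₀ hρ1 (by omega)
        gcongr
  have F : n ^ (k+2) * (ρ ^ k * c) * (α + (α + β * n ^ 2) * (2 * L) / n
      + α * ((2 * L) ^ 3 * (2 * α + β * n ^ 2)) / n ^ 2) ≤ n ^ (k+2) * (ρ ^ k * c) * ρ :=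
    mul_le_mul_of_nonneg_left hρ (by positivity)
  have G : n ^ (k+2) * (ρ ^ k * c) * (α + (α + β * n ^ 2) * (2 * L) / n
      + α * ((2 * L) ^ 3 * (2 * α + β * n ^ 2)) / n ^ 2) =
      α * (n ^ (k+2) * (ρ ^ k * c)) + (α + β * n ^ 2) * ((2 * L) * (n ^ (k+1) * (ρ ^ k * c)))
      + α * (2 * α + β * n ^ 2) * ((2 * L) ^ 3 * (n ^ k * (ρ ^ k * c))) := by
    field_simp
    ring
  rw [G] at F
  have A' := mul_le_mul_of_nonneg_left A h1
  have B'' := mul_le_mul_of_nonneg_left B' (by positivity : 0 ≤ α + β * n ^ 2)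
  have D' := mul_le_mul_of_nonneg_left D (by positivity : 0 ≤ α * (2 * α + β * n ^ 2))
  have : n ^ (k+1+1) * (ρ ^ (k+1) * c) = n ^ (k+2) * (ρ ^ k * c) * ρ := by ring
  rw [this]
  linarith

end Mat
end GM


namespace GM
open MvPolynomial
section GaussMom

lemma gmom_aux (v : ℝ) (f : ℝ → ℝ) (hf : ContDiff ℝ ⊤ f) (hd : ∀ t, deriv f t = v * t * f t) (k : ℕ) :
    ∀ t, iteratedDeriv (k+2) f t = v * t * iteratedDeriv (k+1) f t
      + v * (k+1) * iteratedDeriv k f t := by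
  have hdiff : ∀ m, Differentiable ℝ (iteratedDeriv m f) := fun m =>
    hf.differentiable_iteratedDeriv m (by exact_mod_cast WithTop.coe_lt_top _)
  induction k with
  | zero =>
    intro t
    have h1 : iteratedDeriv 1 f = fun t => v * t * f t := by
      rw [iteratedDeriv_one]; exact funext hd
    rw [iteratedDeriv_succ, zero_add, h1]
    have hf' : Differentiable ℝ f := by simpa using hdiff 0
    have : HasDerivAt (fun t => v * t * f t) (v * 1 * f t + v * t * (deriv f t)) t :=
      ((hasDerivAt_id t).const_mul v).mul (hf' t).hasDerivAt
    rw [this.deriv, hd]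
    simp; ring
  | succ k ih =>
    intro t
    rw [iteratedDeriv_succ, show k + 1 + 1 = k + 2 by ring, funext ih]
    have h1 := ((hasDerivAt_id t).const_mul v).mul (hdiff (k+1) t).hasDerivAt
    have h2 := (hdiff k t).hasDerivAt.const_mul (v * (k+1))
    have h3 := h1.add h2
    rw [← iteratedDeriv_succ, ← iteratedDeriv_succ] at h3
    have := h3.deriv
    simp only [id] at this
    refine (this.trans ?_)
    rw [ih t]
    push_cast
    simp [ih t]
    ring

lemma gmom (v : NNReal) (k : ℕ) :
    ∫ x, x ^ (k+2) ∂(gaussianReal 0 v) = v * (k+1) * ∫ x, x ^ k ∂(gaussianReal 0 v) := by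
  have h : ∀ m, ∫ x, x ^ m ∂(gaussianReal 0 v)
      = iteratedDeriv m (mgf (fun x ↦ x) (gaussianReal 0 v)) 0 := by
    intro m
    rw [iteratedDeriv_mgf_zero] <;> simp
  rw [h, h, gmom_aux v]
  · simp
  · rw [mgf_fun_id_gaussianReal]; fun_prop
  · intro t
    rw [mgf_fun_id_gaussianReal]
    have : HasDerivAt (fun t : ℝ => Real.exp (0 * t + v * t ^ 2 / 2))
      (Real.exp (0 * t + v * t ^ 2 / 2) * (0 * 1 + v * (2 * t ^ 1 * 1) / 2)) t := by
      apply HasDerivAt.exp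
      refine ((hasDerivAt_id t).const_mul 0).add ?_
      refine (((hasDerivAt_id t).pow 2).const_mul (v:ℝ)).div_const 2 |>.congr_deriv ?_
      simp
    rw [this.deriv]; ring

end GaussMom

section GV
variable {Ω : Type*} [MeasurableSpace Ω] {P : Measure Ω} [IsProbabilityMeasure P]
  {σ : Type*} [Fintype σ] {X : σ → Ω → ℝ}

/-- Centered Gaussian vector with respect to a general measure. -/
def GV (P : Measure Ω) (X : σ → Ω → ℝ) : Prop :=
  (∀ i, Measurable (X i)) ∧
    ∀ c : σ → ℝ, ∃ v : NNReal, Measure.map (fun ω => ∑ i, c i * X i ω) P = gaussianReal 0 v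

lemma GV.memLp (h : GV P X) (a : σ) (q : ENNReal) (hq : q ≠ ⊤) : MemLp (X a) q P := by
  classical
  obtain ⟨v, hv⟩ := h.2 (Pi.single a 1)
  have e : (fun ω => ∑ i, (Pi.single a 1 : σ → ℝ) i * X i ω) = X a := by
    funext ω; simp [Pi.single_apply]
  rw [e] at hv
  have := memLp_id_gaussianReal' (μ := 0) (v := v) q hq
  rw [← hv, memLp_map_measure_iff (by fun_prop) (h.1 a).aemeasurable] at this
  simpa using this

lemma GV.memLp_eval (h : GV P X) (p : MvPolynomial σ ℝ) :
    ∀ q : ENNReal, q ≠ ⊤ → MemLp (fun ω => eval (fun a => X a ω) p) q P := by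
  induction p using MvPolynomial.induction_on with
  | C c => intro q hq; simpa using memLp_const c
  | add p p' h1 h2 => intro q hq; simpa [Pi.add_def] using (h1 q hq).add (h2 q hq)
  | mul_X p a hp =>
    intro q hq
    have : ENNReal.HolderTriple (2 * q) (2 * q) q := ⟨by
      rw [ENNReal.mul_inv (by simp) (by simp), ← add_mul, ENNReal.inv_two_add_inv_two, one_mul]⟩
    have := (h.memLp a (2 * q) (ENNReal.mul_ne_top (by simp) hq)).mul
      (hp (2 * q) (ENNReal.mul_ne_top (by simp) hq)) (r := q)
    simpa [Pi.mul_def, mul_comm] using this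

lemma GV.integrable (h : GV P X) (p : MvPolynomial σ ℝ) :
    Integrable (fun ω => eval (fun a => X a ω) p) P :=
  memLp_one_iff_integrable.mp (h.memLp_eval p 1 (by simp))

/-- The expectation functional. -/
noncomputable def GV.E (h : GV P X) : MvPolynomial σ ℝ →ₗ[ℝ] ℝ where
  toFun p := ∫ ω, eval (fun a => X a ω) p ∂P
  map_add' p q := by
    simp only [map_add]; exact integral_add (h.integrable p) (h.integrable q)
  map_smul' c p := by
    simp only [smul_eval, RingHom.id_apply, smul_eq_mul]; exact integral_const_mul _ _

lemma GV.E_apply (h : GV P X) (p : MvPolynomial σ ℝ) :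
    h.E p = ∫ ω, eval (fun a => X a ω) p ∂P := rfl

/-- A linear form. -/
noncomputable def lf (c : σ → ℝ) : MvPolynomial σ ℝ := ∑ a, C (c a) * MvPolynomial.X a

lemma lf_mom {K : σ → σ → ℝ} {E : MvPolynomial σ ℝ →ₗ[ℝ] ℝ} (h : IsGF K E) (c : σ → ℝ) (k : ℕ) :
    E (lf c ^ (k+2)) = (∑ a, ∑ b, c a * c b * K a b) * (k+1) * E (lf c ^ k) := by
  classical
  have h1 : lf c ^ (k+2) = ∑ a, c a • (MvPolynomial.X a * lf c ^ (k+1)) := by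
    rw [show k + 2 = (k+1)+1 by ring, pow_succ']
    nth_rewrite 1 [lf]
    rw [Finset.sum_mul]
    exact Finset.sum_congr rfl fun a _ => by rw [smul_eq_C_mul, mul_assoc]
  have h2 : ∀ b, pderiv b (lf c ^ (k+1)) = ((k+1) * c b) • lf c ^ k := by
    intro b
    have : pderiv b (lf c) = C (c b) := by
      simp [lf, pderiv_X, Pi.single_apply]
    rw [Derivation.leibniz_pow, this]
    simp [smul_eq_C_mul]
    ring
  rw [h1, map_sum]
  simp only [map_smul, h.ibp, h2, smul_eq_mul]
  simp only [Finset.sum_mul, Finset.mul_sum]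
  refine Finset.sum_congr rfl fun a _ => Finset.sum_congr rfl fun b _ => by ring

lemma lf_span {L : MvPolynomial σ ℝ →ₗ[ℝ] ℝ} (h : ∀ c k, L (lf c ^ k) = 0) : L = 0 := by
  classical
  have key : ∀ d : σ →₀ ℕ, L (monomial d 1) = 0 := by
    intro d
    set m := ∑ i, d i with hm
    let F : MvPolynomial σ ℝ := ∑ k ∈ Finset.piAntidiag (Finset.univ : Finset σ) m,
      monomial (Finsupp.equivFunOnFinite.symm k)
        (Nat.multinomial Finset.univ k * L (monomial (Finsupp.equivFunOnFinite.symm k) 1))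
    have hF : F = 0 := by
      apply MvPolynomial.funext
      intro c
      rw [map_zero, ← h c m, lf, Finset.sum_pow_eq_sum_piAntidiag, map_sum, map_sum]
      refine Finset.sum_congr rfl fun k _ => ?_
      have e : (∏ i, (C (c i) * MvPolynomial.X i : MvPolynomial σ ℝ) ^ k i) =
          (∏ i, c i ^ k i) • monomial (Finsupp.equivFunOnFinite.symm k) 1 := by
        rw [monomial_eq, smul_eq_C_mul]
        simp only [mul_pow, Finset.prod_mul_distrib, map_prod, map_pow, map_one, one_mul]
        rw [Finsupp.prod_fintype _ _ (by simp)]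
        simp
      rw [e, eval_monomial, Finsupp.prod_fintype _ _ (by simp)]
      conv_rhs => rw [← nsmul_eq_mul, map_nsmul, map_smul, nsmul_eq_mul, smul_eq_mul]
      simp
      ring
    have h2 : F.coeff d = Nat.multinomial Finset.univ d * L (monomial d 1) := by
      simp only [F, coeff_sum, coeff_monomial]
      rw [Finset.sum_eq_single (d : σ → ℕ)]
      · simp
      · intro b _ hb
        rw [if_neg]
        intro hh
        apply hb
        rw [← hh]; simp
      · intro hh
        exfalso; apply hh
        simp [hm]
    rw [hF, coeff_zero] at h2
    have h3 : (Nat.multinomial Finset.univ d : ℝ) ≠ 0 := by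
      exact_mod_cast (Nat.multinomial_pos _ _).ne'
    exact (mul_eq_zero.mp h2.symm).resolve_left h3
  refine LinearMap.ext fun p => ?_
  rw [p.as_sum, map_sum, LinearMap.zero_apply]
  refine Finset.sum_eq_zero fun d _ => ?_
  have e : monomial d (coeff d p) = (coeff d p) • monomial d (1:ℝ) := by
    rw [smul_monomial]; simp
  rw [e, map_smul, key d, smul_zero]

theorem GV.isGF (h : GV P X) : IsGF (fun a b => ∫ ω, X a ω * X b ω ∂P) h.E := by
  classical
  obtain ⟨E', hE'⟩ := exists_isGF (fun a b => ∫ ω, X a ω * X b ω ∂P)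
    (fun a b => by simp only [mul_comm])
  have hv : ∀ c : σ → ℝ, ∃ v : NNReal, ∀ k, h.E (lf c ^ k) = ∫ x, x ^ k ∂(gaussianReal 0 v) := by
    intro c
    obtain ⟨v, hv⟩ := h.2 c
    refine ⟨v, fun k => ?_⟩
    have hm : Measurable (fun ω => ∑ i, c i * X i ω) :=
      Finset.measurable_sum _ fun i _ => (h.1 i).const_mul _
    rw [← hv, integral_map hm.aemeasurable (by fun_prop), h.E_apply]
    simp [lf]
  have key : h.E - E' = 0 := by
    apply lf_span
    intro c
    obtain ⟨v, hv⟩ := hv c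
    have h2 : (v : ℝ) = ∑ a, ∑ b, c a * c b * ∫ ω, X a ω * X b ω ∂P := by
      have e1 := gmom v 0
      simp at e1
      have e2 := hv 2
      rw [e1] at e2
      rw [← e2]
      have : lf c ^ 2 = ∑ a, ∑ b, (c a * c b) • (MvPolynomial.X a * MvPolynomial.X b) := by
        rw [sq, lf, Finset.sum_mul_sum]
        refine Finset.sum_congr rfl fun a _ => Finset.sum_congr rfl fun b _ => ?_
        rw [smul_eq_C_mul, map_mul]; ring
      rw [this, map_sum]
      refine Finset.sum_congr rfl fun a _ => ?_
      rw [map_sum]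
      refine Finset.sum_congr rfl fun b _ => ?_
      rw [map_smul, smul_eq_mul, h.E_apply]
      simp
    have h3 : ∀ k, h.E (lf c ^ k) = E' (lf c ^ k) := by
      intro k
      induction k using Nat.twoStepInduction with
      | zero => rw [hv]; simp [hE'.one]
      | one =>
        rw [hv]
        have : E' (lf c) = 0 := by
          rw [lf, map_sum]
          refine Finset.sum_eq_zero fun a _ => ?_
          have := hE'.ibp a 1
          simp at this
          rw [← smul_eq_C_mul, map_smul, this]; simp
        simp [this]
      | more k ih _ =>
        rw [lf_mom hE', ← ih, hv, hv, gmom, h2]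
    intro k
    simp [h3 k]
  rw [sub_eq_zero] at key
  rw [key]; exact hE'

end GV
end GM


namespace GM
open MvPolynomial
section Spec
variable {ι : Type*} [Fintype ι] [DecidableEq ι]

lemma spec (A : Matrix ι ι ℝ) (hA : A.IsSymm) : ∃ (l : ι → ℝ) (U : Matrix ι ι ℝ),
    U * U.transpose = 1 ∧ U.transpose * U = 1 ∧
    ∀ m : ℕ, A ^ m = U * Matrix.diagonal (fun k => l k ^ m) * U.transpose := by
  have hH : A.IsHermitian := by
    rw [Matrix.IsHermitian, Matrix.conjTranspose_eq_transpose_of_trivial]; exact hA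
  have hU1 : (hH.eigenvectorUnitary : Matrix ι ι ℝ) * (hH.eigenvectorUnitary : Matrix ι ι ℝ).transpose = 1 := by
    have := Unitary.coe_mul_star_self hH.eigenvectorUnitary
    rwa [Unitary.coe_star, Matrix.star_eq_conjTranspose, Matrix.conjTranspose_eq_transpose_of_trivial] at this
  have hU2 : (hH.eigenvectorUnitary : Matrix ι ι ℝ).transpose * (hH.eigenvectorUnitary : Matrix ι ι ℝ) = 1 := by
    have := Unitary.coe_star_mul_self hH.eigenvectorUnitary
    rwa [Matrix.star_eq_conjTranspose, Matrix.conjTranspose_eq_transpose_of_trivial] at this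
  refine ⟨hH.eigenvalues, hH.eigenvectorUnitary, hU1, hU2, fun m => ?_⟩
  have h1 : A = (hH.eigenvectorUnitary : Matrix ι ι ℝ) * Matrix.diagonal hH.eigenvalues *
      (hH.eigenvectorUnitary : Matrix ι ι ℝ).transpose := by
    have := hH.spectral_theorem
    rw [Unitary.conjStarAlgAut_apply] at this
    rw [Matrix.star_eq_conjTranspose, Matrix.conjTranspose_eq_transpose_of_trivial] at this
    exact this
  generalize (hH.eigenvectorUnitary : Matrix ι ι ℝ) = U at *
  generalize hH.eigenvalues = l at *
  induction m with
  | zero => simp [hU1]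
  | succ m ih =>
    rw [pow_succ, ih]
    nth_rewrite 1 [h1]
    calc U * Matrix.diagonal (fun k => l k ^ m) * U.transpose * (U * Matrix.diagonal l * U.transpose)
        = U * Matrix.diagonal (fun k => l k ^ m) * (U.transpose * U) * Matrix.diagonal l * U.transpose := by
          simp only [Matrix.mul_assoc]
      _ = _ := by
          rw [hU2, Matrix.mul_one, Matrix.mul_assoc U, Matrix.diagonal_mul_diagonal]
          simp only [pow_succ]

lemma spec_trace {A : Matrix ι ι ℝ} {l : ι → ℝ} {U : Matrix ι ι ℝ} (hU : U.transpose * U = 1)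
    {m : ℕ} (h : A ^ m = U * Matrix.diagonal (fun k => l k ^ m) * U.transpose) :
    ∑ i, (A ^ m) i i = ∑ k, l k ^ m := by
  have : ∑ i, (A ^ m) i i = Matrix.trace (A ^ m) := rfl
  rw [this, h, Matrix.trace_mul_comm, ← Matrix.mul_assoc, hU, Matrix.one_mul, Matrix.trace_diagonal]

lemma spec_SS {A : Matrix ι ι ℝ} {l : ι → ℝ} {U : Matrix ι ι ℝ}
    {m : ℕ} (h : A ^ m = U * Matrix.diagonal (fun k => l k ^ m) * U.transpose) :
    ∑ a : ι × ι, (A ^ m) a.1 a.2 = ∑ k, l k ^ m * (∑ i, U i k) ^ 2 := by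
  rw [h, Fintype.sum_prod_type]
  have e0 : ∀ i j, (U * Matrix.diagonal (fun k => l k ^ m) * U.transpose) i j =
      ∑ k, U i k * l k ^ m * U j k := by
    intro i j
    rw [Matrix.mul_apply]
    simp only [Matrix.mul_diagonal, Matrix.transpose_apply]
  simp only [e0]
  have : ∀ k, l k ^ m * (∑ i, U i k) ^ 2 = ∑ i, ∑ j, U i k * l k ^ m * U j k := by
    intro k
    rw [sq, Finset.sum_mul_sum, Finset.mul_sum]
    refine Finset.sum_congr rfl fun i _ => ?_
    rw [Finset.mul_sum]
    exact Finset.sum_congr rfl fun j _ => by ring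
  simp only [this]
  have e : ∀ i, ∑ j, ∑ k, U i k * l k ^ m * U j k = ∑ k, ∑ j, U i k * l k ^ m * U j k :=
    fun i => Finset.sum_comm
  simp only [e]
  exact Finset.sum_comm

lemma spec_w {U : Matrix ι ι ℝ} (hU : U * U.transpose = 1) :
    ∑ k, (∑ i, U i k) ^ 2 = Fintype.card ι := by
  have := spec_SS (A := (1 : Matrix ι ι ℝ)) (l := fun _ => 1) (U := U) (m := 0) (by simp [hU])
  simp only [pow_zero, one_mul] at this
  rw [← this, Fintype.sum_prod_type]
  simp [Matrix.one_apply]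

lemma pow_mix (x y T : ℝ) (r s : ℕ) (h1 : |x| ^ (r+s) ≤ T) (h2 : |y| ^ (r+s) ≤ T) :
    x ^ r * y ^ s ≤ T := by
  refine (le_abs_self _).trans ?_
  rw [abs_mul, abs_pow, abs_pow]
  rcases le_total |x| |y| with h | h
  · refine le_trans ?_ h2
    rw [pow_add]; gcongr
  · refine le_trans ?_ h1
    rw [pow_add]; gcongr

lemma det_SS (A : Matrix ι ι ℝ) (hA : A.IsSymm) (r s : ℕ) (hrs : Even (r+s)) :
    (∑ a : ι × ι, (A ^ r) a.1 a.2) * (∑ a : ι × ι, (A ^ s) a.1 a.2) ≤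
      (Fintype.card ι : ℝ) ^ 2 * ∑ i, (A ^ (r+s)) i i := by
  obtain ⟨l, U, h1, h2, h3⟩ := spec A hA
  rw [spec_SS (h3 r), spec_SS (h3 s), spec_trace h2 (h3 _), ← spec_w h1, sq,
    Finset.sum_mul_sum, Finset.sum_mul_sum, Finset.sum_mul]
  refine Finset.sum_le_sum fun k _ => ?_
  rw [Finset.sum_mul]
  refine Finset.sum_le_sum fun j _ => ?_
  have hT : ∀ k, |l k| ^ (r+s) ≤ ∑ k, l k ^ (r+s) := by
    intro k
    rw [hrs.pow_abs]
    exact Finset.single_le_sum (f := fun k => l k ^ (r+s)) (fun i _ => hrs.pow_nonneg _)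
      (Finset.mem_univ k)
  have := mul_le_mul_of_nonneg_left (pow_mix _ _ _ r s (hT k) (hT j))
    (by positivity : 0 ≤ (∑ i, U i k) ^ 2 * (∑ i, U i j) ^ 2)
  linarith

lemma eval_Mg_pow (x : ι × ι → ℝ) (m : ℕ) (i j : ι) :
    eval x ((Mg ι ^ m) i j) = ((Matrix.of fun i j => x (i, j)) ^ m) i j := by
  have : (eval x).mapMatrix (Mg ι ^ m) = (Matrix.of fun i j => x (i, j)) ^ m := by
    rw [map_pow]
    congr 1
    ext i j
    simp [Mg]
  rw [← this]; rfl

lemma eval_TT (x : ι × ι → ℝ) (m : ℕ) :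
    eval x (TT ι m) = ∑ i, ((Matrix.of fun i j => x (i, j)) ^ m) i i := by
  simp [TT, eval_Mg_pow]

end Spec

section Y
variable {ι : Type*} [Fintype ι] [DecidableEq ι]

/-- Negation automorphism. -/
lemma GV.E_odd {Ω : Type*} [MeasurableSpace Ω] {P : Measure Ω} [IsProbabilityMeasure P]
    {X : ι × ι → Ω → ℝ} (h : GV P X) (r : ℕ) (hr : Odd r) : h.E (TT ι r) = 0 := by
  have hn : GV P (fun a ω => - X a ω) := by
    refine ⟨fun i => (h.1 i).neg, fun c => ?_⟩
    obtain ⟨v, hv⟩ := h.2 (fun i => - c i)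
    refine ⟨v, ?_⟩
    rw [← hv]
    congr 1
    funext ω
    exact Finset.sum_congr rfl fun i _ => by ring
  have h1 := hn.isGF
  simp only [neg_mul_neg] at h1
  have h2 := h.isGF.unique h1 (TT ι r) (TT_nn r)
  have h3 : hn.E (TT ι r) = - h.E (TT ι r) := by
    rw [GV.E_apply, GV.E_apply, ← integral_neg]
    congr 1
    funext ω
    rw [eval_TT, eval_TT, ← Finset.sum_neg_distrib]
    have : (Matrix.of fun i j => - X (i, j) ω) = - (Matrix.of fun i j => X (i, j) ω) := by
      ext i j; simp
    rw [this, hr.neg_pow]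
    rfl
  linarith

lemma GV.posY {Ω : Type*} [MeasurableSpace Ω] {P : Measure Ω} [IsProbabilityMeasure P]
    {X : ι × ι → Ω → ℝ} (h : GV P X) (hs : ∀ i j ω, X (i, j) ω = X (j, i) ω) : PosY h.E := by
  have hsym : ∀ ω, (Matrix.of fun i j => X (i, j) ω).IsSymm := by
    intro ω; ext i j; simp [hs i j]
  refine ⟨fun r s => ?_, fun r s hrs => ?_, h.E_odd⟩
  · rw [GV.E_apply, GV.E_apply]
    congr 1
    funext ω
    rw [eval_TT, DD, map_sum]
    simp only [map_mul, eval_Mg_pow]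
    rw [Fintype.sum_prod_type]
    refine Finset.sum_congr rfl fun i _ => ?_
    rw [pow_add, Matrix.mul_apply]
    refine Finset.sum_congr rfl fun j _ => ?_
    rw [((hsym ω).pow s).apply]
  · rw [GV.E_apply, GV.E_apply, ← integral_const_mul]
    refine integral_mono (h.integrable _) ((h.integrable _).const_mul _) fun ω => ?_
    simp only
    rw [eval_TT, map_mul, SS, SS, map_sum, map_sum]
    simp only [eval_Mg_pow]
    exact det_SS _ (hsym ω) r s hrs

/-- Gaussian family from linear forms of a standard Gaussian. -/
lemma std_GV {τ : Type*} [Fintype τ] {σ : Type*} [Fintype σ] (e : σ → EuclideanSpace ℝ τ) :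
    GV (stdGaussian (EuclideanSpace ℝ τ)) (fun a ω => inner ℝ (e a) ω) := by
  refine ⟨fun a => by fun_prop, fun c => ?_⟩
  have : (fun ω => ∑ i, c i * inner ℝ (e i) ω) = (innerSL ℝ (∑ i, c i • e i) : StrongDual ℝ (EuclideanSpace ℝ τ)) := by
    funext ω
    simp [sum_inner, inner_smul_left]
  rw [this, IsGaussian.map_eq_gaussianReal, integral_strongDual_stdGaussian]
  exact ⟨_, rfl⟩

lemma std_cov {τ : Type*} [Fintype τ] (x y : EuclideanSpace ℝ τ) :
    ∫ ω, inner ℝ x ω * inner ℝ y ω ∂(stdGaussian (EuclideanSpace ℝ τ)) = inner ℝ x y := by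
  have h1 : ∀ z : EuclideanSpace ℝ τ, ∫ ω, inner ℝ z ω ∂(stdGaussian (EuclideanSpace ℝ τ)) = 0 :=
    fun z => integral_strongDual_stdGaussian (innerSL ℝ z : StrongDual ℝ (EuclideanSpace ℝ τ))
  have h2 := covarianceBilin_apply_eq_cov (μ := stdGaussian (EuclideanSpace ℝ τ))
    IsGaussian.memLp_two_id x y
  rw [covarianceBilin_stdGaussian] at h2
  rw [covariance, h1, h1] at h2
  simp only [sub_zero] at h2
  rw [← h2]; rfl

/-- The comparison functional exists with good positivity properties. -/
theorem exists_Y {α β : ℝ} (hα : 0 ≤ α) (hβ : 0 ≤ β) :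
    ∃ E : MvPolynomial (ι × ι) ℝ →ₗ[ℝ] ℝ, IsGF (KK α α β) E ∧ PosY E := by
  let b : Option (ι × ι) → EuclideanSpace ℝ (Option (ι × ι)) := fun d => EuclideanSpace.single d 1
  have hb : ∀ d d', inner ℝ (b d) (b d') = if d = d' then (1:ℝ) else 0 := by
    intro d d'
    simp [b, EuclideanSpace.inner_single_left, eq_comm]
  let e : ι × ι → EuclideanSpace ℝ (Option (ι × ι)) := fun a =>
    Real.sqrt (α / 2) • (b (some a) + b (some (a.2, a.1))) + Real.sqrt β • b none
  have h := std_GV e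
  refine ⟨h.E, ?_, h.posY ?_⟩
  · have h1 := h.isGF
    have : (fun a b => ∫ ω, inner ℝ (e a) ω * inner ℝ (e b) ω
        ∂(stdGaussian (EuclideanSpace ℝ (Option (ι × ι))))) = KK α α β := by
      funext x y
      rw [std_cov]
      simp only [e, inner_add_left, inner_add_right, inner_smul_left, inner_smul_right, hb]
      have hs1 := Real.mul_self_sqrt (by positivity : 0 ≤ α / 2)
      have hs2 := Real.mul_self_sqrt hβ
      obtain ⟨x1, x2⟩ := x
      obtain ⟨y1, y2⟩ := y
      simp only [KK, Option.some.injEq, Prod.mk.injEq, reduceCtorEq, if_false, conj_trivial]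
      have c1 : (x2 = y2 ∧ x1 = y1) = (y1 = x1 ∧ y2 = x2) := by
        apply propext; constructor <;> (rintro ⟨rfl, rfl⟩; simp)
      have c2 : (x1 = y1 ∧ x2 = y2) = (y1 = x1 ∧ y2 = x2) := by
        apply propext; constructor <;> (rintro ⟨rfl, rfl⟩; simp)
      have c3 : (x2 = y1 ∧ x1 = y2) = (y1 = x2 ∧ y2 = x1) := by
        apply propext; constructor <;> (rintro ⟨rfl, rfl⟩; simp)
      have c4 : (x1 = y2 ∧ x2 = y1) = (y1 = x2 ∧ y2 = x1) := by
        apply propext; constructor <;> (rintro ⟨rfl, rfl⟩; simp)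
      simp only [c1, c2, c3, c4]
      generalize (if (y1 = x1 ∧ y2 = x2) then (1:ℝ) else 0) = u
      generalize (if (y1 = x2 ∧ y2 = x1) then (1:ℝ) else 0) = w
      simp only [mul_zero, add_zero, zero_add, if_true, mul_one]
      linear_combination (2 * u + 2 * w) * hs1 + hs2
    rwa [this] at h1
  · intro i j ω
    simp only [e]
    rw [add_comm (b (some (i, j)))]

end Y
end GM


namespace GM
open MvPolynomial

section Lam
lemma lam1_spec {n : ℕ} (hn : 0 < n) (A : Matrix (Fin n) (Fin n) ℝ) (hA : A.IsSymm) :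
    ∃ l : Fin n → ℝ, (∀ m : ℕ, ∑ i, (A ^ m) i i = ∑ k, l k ^ m) ∧ (∀ k, l k ≤ lam1 A) ∧
      ∃ k, lam1 A = l k := by
  obtain ⟨l, U, h1, h2, h3⟩ := spec A hA
  have hA1 : A = U * Matrix.diagonal l * U.transpose := by
    have := h3 1
    simpa using this
  have hset : {t : ℝ | ∃ v : Fin n → ℝ, v ≠ 0 ∧ A.mulVec v = t • v} = Set.range l := by
    ext t
    constructor
    · rintro ⟨v, hv, hAv⟩
      set w := U.transpose.mulVec v with hw
      have hUw : U.mulVec w = v := by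
        rw [hw, Matrix.mulVec_mulVec, h1, Matrix.one_mulVec]
      have hw0 : w ≠ 0 := by
        intro h0
        apply hv
        rw [← hUw, h0, Matrix.mulVec_zero]
      have h4 : (Matrix.diagonal l).mulVec w = t • w := by
        have : U.transpose.mulVec (A.mulVec v) = t • w := by
          rw [hAv, Matrix.mulVec_smul]
        rw [← this, hA1, hw, Matrix.mulVec_mulVec, Matrix.mulVec_mulVec, ← Matrix.mul_assoc,
          ← Matrix.mul_assoc, h2, Matrix.one_mul]
      obtain ⟨k, hk⟩ := Function.ne_iff.mp hw0
      refine ⟨k, ?_⟩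
      have h5 := congrFun h4 k
      rw [Matrix.mulVec_diagonal] at h5
      simp only [Pi.smul_apply, smul_eq_mul] at h5
      exact mul_right_cancel₀ hk h5
    · rintro ⟨k, rfl⟩
      refine ⟨U.mulVec (Pi.single k 1), ?_, ?_⟩
      · intro h0
        have h6 : U.transpose.mulVec (U.mulVec (Pi.single k 1)) = 0 := by
          rw [h0, Matrix.mulVec_zero]
        rw [Matrix.mulVec_mulVec, h2, Matrix.one_mulVec] at h6
        have := congrFun h6 k
        simp at this
      · have e : A * U = U * Matrix.diagonal l := by
          rw [hA1, Matrix.mul_assoc, h2, Matrix.mul_one]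
        rw [Matrix.mulVec_mulVec, e, ← Matrix.mulVec_mulVec, ← Matrix.mulVec_smul]
        congr 1
        ext i
        rw [Matrix.mulVec_diagonal]
        by_cases hik : i = k
        · subst hik; simp
        · simp [hik]
  have hne : (Set.range l).Nonempty := ⟨l ⟨0, hn⟩, ⟨_, rfl⟩⟩
  have hfin : (Set.range l).Finite := Set.finite_range l
  refine ⟨l, fun m => spec_trace h2 (h3 m), fun k => ?_, ?_⟩
  · rw [lam1, hset]
    exact le_csSup hfin.bddAbove ⟨k, rfl⟩
  · rw [lam1, hset]
    obtain ⟨k, hk⟩ := hne.csSup_mem hfin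
    exact ⟨k, hk.symm⟩

/-- If the trace of an even power is small then so is the top eigenvalue. -/
lemma lam1_lt {n : ℕ} (hn : 0 < n) (A : Matrix (Fin n) (Fin n) ℝ) (hA : A.IsSymm) (s : ℝ)
    (hs : 0 ≤ s) (k : ℕ) (h : ∑ i, (A ^ (2 * k)) i i < s ^ (2 * k)) : lam1 A < s := by
  obtain ⟨l, h1, h2, j, hj⟩ := lam1_spec hn A hA
  by_contra! hcon
  rw [h1] at h
  have h3 : l j ^ (2 * k) ≤ ∑ k', l k' ^ (2 * k) :=
    Finset.single_le_sum (f := fun i => l i ^ (2 * k)) (fun i _ => (even_two_mul k).pow_nonneg _)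
      (Finset.mem_univ j)
  have h4 : s ^ (2 * k) ≤ l j ^ (2 * k) := by
    rw [hj] at hcon
    gcongr
  linarith

lemma lam1_ge {n : ℕ} (hn : 0 < n) (A : Matrix (Fin n) (Fin n) ℝ) (hA : A.IsSymm) (q : ℕ) :
    ∑ i, (A ^ (2 * q + 3)) i i + 4 * ∑ i, (A ^ (2 * q + 2)) i i + 4 * ∑ i, (A ^ (2 * q + 1)) i i ≤
    lam1 A * (∑ i, (A ^ (2 * q + 2)) i i + 4 * ∑ i, (A ^ (2 * q + 1)) i i
      + 4 * ∑ i, (A ^ (2 * q)) i i) := by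
  obtain ⟨l, h1, h2, -⟩ := lam1_spec hn A hA
  simp only [h1]
  have : 0 ≤ ∑ k, l k ^ (2 * q) * (l k + 2) ^ 2 * (lam1 A - l k) := by
    refine Finset.sum_nonneg fun k _ => ?_
    have := h2 k
    have := (even_two_mul q).pow_nonneg (l k)
    have : 0 ≤ lam1 A - l k := by linarith [h2 k]
    positivity
  have e : ∑ k, l k ^ (2 * q) * (l k + 2) ^ 2 * (lam1 A - l k) =
      lam1 A * (∑ k, l k ^ (2 * q + 2) + 4 * ∑ k, l k ^ (2 * q + 1) + 4 * ∑ k, l k ^ (2 * q))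
      - (∑ k, l k ^ (2 * q + 3) + 4 * ∑ k, l k ^ (2 * q + 2) + 4 * ∑ k, l k ^ (2 * q + 1)) := by
    simp only [Finset.mul_sum, ← Finset.sum_add_distrib, ← Finset.sum_sub_distrib]
    exact Finset.sum_congr rfl fun k _ => by ring
  linarith

end Lam

section Bounds
variable {ι : Type*} [Fintype ι] [DecidableEq ι]

structure MB (E : MvPolynomial (ι × ι) ℝ →ₗ[ℝ] ℝ) (α β ρ : ℝ) (L : ℕ) : Prop where
  up : ∀ k ≤ L, E (TT ι (2 * k)) ≤ (Fintype.card ι : ℝ) ^ (k + 1) * (ρ ^ k * catalan k)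
  low : ∀ k ≤ L, (Fintype.card ι : ℝ) ^ (k + 1) * ((2 - ρ ^ k) * catalan k) ≤ E (TT ι (2 * k))
  var : ∀ m ≤ L, E (TT ι (m + 1) * TT ι (m + 1)) - E (TT ι (m + 1)) * E (TT ι (m + 1)) ≤
    (m + 1) * (m + 1) * ((2 * α + β * (Fintype.card ι : ℝ) ^ 2) *
      ((Fintype.card ι : ℝ) ^ (m + 1) * (ρ ^ m * catalan m)))

theorem bounds {Ω : Type*} [MeasurableSpace Ω] {P : Measure Ω} [IsProbabilityMeasure P]
    {X : ι × ι → Ω → ℝ} (h : GV P X) (hs : ∀ i j ω, X (i, j) ω = X (j, i) ω)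
    {δ β : ℝ} (hδ : 0 ≤ δ) (hβ : 0 ≤ β) (hι : 0 < Fintype.card ι)
    (hv : ∀ a, |(∫ ω, X a ω * X a ω ∂P) - 1| ≤ δ)
    (hc : ∀ a b, b ≠ a → b ≠ (a.2, a.1) → |∫ ω, X a ω * X b ω ∂P| ≤ β)
    (ρ : ℝ) (L : ℕ) (hρ1 : 1 ≤ ρ)
    (hρ : (1 + δ) + ((1 + δ) + β * (Fintype.card ι : ℝ) ^ 2) * (2 * L) / (Fintype.card ι : ℝ)
      + (1 + δ) * ((2 * L) ^ 3 * (2 * (1 + δ) + β * (Fintype.card ι : ℝ) ^ 2))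
        / (Fintype.card ι : ℝ) ^ 2 ≤ ρ) :
    MB h.E (1 + δ) β ρ L := by
  obtain ⟨EY, hY, hP⟩ := exists_Y (ι := ι) (α := 1 + δ) (β := β) (by linarith) hβ
  obtain ⟨E0, h0⟩ := exists_isGF (KK (ι := ι) 1 0 0) (KK_symm 1 0 0)
  have hG := h.isGF
  set K : ι × ι → ι × ι → ℝ := fun a b => ∫ ω, X a ω * X b ω ∂P with hKdef
  have hfl : ∀ a, K a (a.2, a.1) = K a a := by
    intro a
    simp only [hKdef]
    congr 1
    funext ω
    rw [hs a.2 a.1]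
  have hK : ∀ a b, |K a b| ≤ KK (1 + δ) (1 + δ) β a b := by
    intro a b
    have h1 := abs_le.mp (hv a)
    have h2 : |K a a| ≤ 1 + δ := abs_le.mpr ⟨by linarith [h1.1], by linarith [h1.2]⟩
    unfold KK
    by_cases e1 : b = (a.2, a.1)
    · rw [e1, hfl, if_pos rfl]
      split_ifs <;> linarith
    · by_cases e2 : b = a
      · rw [e2, if_pos rfl]
        split_ifs <;> linarith
      · rw [if_neg e1, if_neg e2]
        have := hc a b e2 e1
        linarith
  have hK' : ∀ a b, |K a b - KK 1 0 0 a b| ≤ KK (1 + δ) (1 + δ) β a b - KK 1 0 0 a b := by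
    intro a b
    have h1 := abs_le.mp (hv a)
    have h2 : |K a a| ≤ 1 + δ := abs_le.mpr ⟨by linarith [h1.1], by linarith [h1.2]⟩
    have h3 : |K a a - 1| ≤ δ := hv a
    unfold KK
    by_cases e1 : b = (a.2, a.1)
    · rw [e1, hfl, if_pos rfl]
      simp only [mul_one, zero_mul, add_zero]
      split_ifs <;> linarith
    · rw [if_neg e1]
      simp only [mul_zero, zero_mul, add_zero, sub_zero]
      by_cases e2 : b = a
      · rw [e2, if_pos rfl]
        linarith
      · rw [if_neg e2]
        have := hc a b e2 e1
        linarith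
  have up := upperY (by linarith : (0:ℝ) ≤ 1 + δ) hβ hι hY hP L ρ hρ1 hρ
  refine ⟨fun k hk => ?_, fun k hk => ?_, fun m hm => ?_⟩
  · exact ((le_abs_self _).trans (hG.dom hY hK _ (TT_nn _))).trans (up k hk)
  · have h1 := abs_le.mp (hG.dom_sub hY h0 hK (KK_nonneg (by simp) le_rfl le_rfl) hK' _
      (TT_nn (ι := ι) (2 * k)))
    have h2 := lowerW h0 k
    have h3 := up k hk
    have h4 : (Fintype.card ι : ℝ) ^ (k + 1) * ((2 - ρ ^ k) * catalan k) =
      2 * ((Fintype.card ι : ℝ) ^ (k + 1) * catalan k) -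
        (Fintype.card ι : ℝ) ^ (k + 1) * (ρ ^ k * catalan k) := by ring
    rw [h4]
    linarith [h1.1]
  · have h1 := (le_abs_self _).trans (hG.cov_dom hY hK _ _ (TT_nn (ι := ι) (m+1)) (TT_nn (m+1)))
    have h2 := covY (by linarith : (0:ℝ) ≤ 1 + δ) hβ hY hP m m (by simp)
    have h3 := up m hm
    rw [← two_mul] at h2
    have h5 : (0:ℝ) ≤ 2 * (1 + δ) + β * (Fintype.card ι : ℝ) ^ 2 := by positivity
    have h6 := mul_le_mul_of_nonneg_left h3 h5
    have h7 := mul_le_mul_of_nonneg_left h6 (by positivity : (0:ℝ) ≤ (m+1) * (m+1))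
    linarith

end Bounds
end GM


namespace GM
open MvPolynomial

section Prob

lemma ae_tendsto_zero {Ω : Type*} [MeasurableSpace Ω] {P : Measure Ω} (g : ℕ → Ω → ℝ)
    (hg : ∀ n ω, 0 ≤ g n ω) (hi : ∀ n, Integrable (g n) P) (s : ℕ → ℝ) (hs : Summable s)
    (hb : ∀ᶠ n in atTop, ∫ ω, g n ω ∂P ≤ s n) :
    ∀ᵐ ω ∂P, Tendsto (fun n => g n ω) atTop (𝓝 0) := by
  have h1 : Summable (fun n => ∫ ω, g n ω ∂P) := by
    refine Summable.of_norm_bounded_eventually_nat hs ?_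
    filter_upwards [hb] with n hn
    rwa [Real.norm_of_nonneg (integral_nonneg (hg n))]
  have h2 : ∑' n, ENNReal.ofReal (∫ ω, g n ω ∂P) ≠ ⊤ := h1.tsum_ofReal_ne_top
  have h3 : ∫⁻ ω, ∑' n, ENNReal.ofReal (g n ω) ∂P ≠ ⊤ := by
    rw [lintegral_tsum (fun n => (hi n).aemeasurable.ennreal_ofReal)]
    convert h2 using 4 with n
    rw [ofReal_integral_eq_lintegral_ofReal (hi n) (Eventually.of_forall (hg n))]
  have h4 := ae_lt_top' (AEMeasurable.tsum
    (fun n => (hi n).aemeasurable.ennreal_ofReal)) h3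
  filter_upwards [h4] with ω hω
  have h5 := ENNReal.tendsto_atTop_zero_of_tsum_ne_top hω.ne
  have h6 := (ENNReal.tendsto_toReal ENNReal.zero_ne_top).comp h5
  refine (h6.congr fun n => ?_)
  simp [ENNReal.toReal_ofReal (hg n ω)]

lemma L_mul (K : ℝ) (hK : 0 ≤ K) (t : ℝ) (ht : 0 < t) :
    Tendsto (fun n : ℕ => (⌈K * Real.log n⌉₊ : ℝ) * (n : ℝ) ^ (-t)) atTop (𝓝 0) := by
  have h1 : Tendsto (fun x : ℝ => Real.log x * x ^ (-t)) atTop (𝓝 0) := by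
    have := (isLittleO_log_rpow_atTop ht).tendsto_div_nhds_zero
    refine this.congr' ?_
    filter_upwards [eventually_gt_atTop 0] with x hx
    rw [Real.rpow_neg hx.le, div_eq_mul_inv]
  have h2 : Tendsto (fun x : ℝ => x ^ (-t)) atTop (𝓝 0) := tendsto_rpow_neg_atTop ht
  have h3 : Tendsto (fun x : ℝ => K * (Real.log x * x ^ (-t)) + x ^ (-t)) atTop (𝓝 0) := by
    simpa using (h1.const_mul K).add h2
  refine squeeze_zero' (Eventually.of_forall fun n => by positivity) ?_
    (h3.comp tendsto_natCast_atTop_atTop)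
  filter_upwards [eventually_ge_atTop 1] with n hn
  have hl : 0 ≤ Real.log n := Real.log_natCast_nonneg n
  have h4 := (Nat.ceil_lt_add_one (mul_nonneg hK hl)).le
  have h5 : 0 ≤ (n : ℝ) ^ (-t) := by positivity
  simp only [Function.comp]
  nlinarith

lemma pow3 {x : ℝ} (hx : 0 ≤ x) (a t : ℝ) : (a * x ^ (-(t / 3))) ^ 3 = a ^ 3 * x ^ (-t) := by
  rw [mul_pow, ← Real.rpow_natCast (x ^ (-(t / 3))) 3, ← Real.rpow_mul hx]
  congr 2
  push_cast
  ring

noncomputable def RR (C ε K : ℝ) (n : ℕ) : ℝ :=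
  (1 + C / Real.log n ^ 2) + ((1 + C / Real.log n ^ 2) + (C * (n : ℝ) ^ (-(1 + ε))) * (n : ℝ) ^ 2) *
    (2 * (⌈K * Real.log n⌉₊ : ℝ)) / n +
    (1 + C / Real.log n ^ 2) * ((2 * (⌈K * Real.log n⌉₊ : ℝ)) ^ 3 *
      (2 * (1 + C / Real.log n ^ 2) + (C * (n : ℝ) ^ (-(1 + ε))) * (n : ℝ) ^ 2)) / (n : ℝ) ^ 2

lemma tendsto_alpha (C : ℝ) :
    Tendsto (fun n : ℕ => 1 + C / Real.log n ^ 2) atTop (𝓝 1) := by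
  have h : Tendsto (fun n : ℕ => Real.log n ^ 2) atTop atTop :=
    (tendsto_pow_atTop (by norm_num)).comp (Real.tendsto_log_atTop.comp tendsto_natCast_atTop_atTop)
  simpa using (h.const_div_atTop C).const_add 1

lemma tendsto_RR (C ε K : ℝ) (hε : 0 < ε) (hK : 0 ≤ K) :
    Tendsto (RR C ε K) atTop (𝓝 1) := by
  have ha := tendsto_alpha C
  have e1 := L_mul K hK 1 one_pos
  have e2 := L_mul K hK ε hε
  have e3 := (L_mul K hK (2 / 3) (by norm_num)).pow 3
  have e4 := (L_mul K hK ((1 + ε) / 3) (by linarith)).pow 3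
  have := ((ha.add ((ha.mul e1).const_mul 2)).add (e2.const_mul (2 * C))).add
    ((((ha.mul ha).mul e3).const_mul 16).add ((ha.mul e4).const_mul (8 * C)))
  norm_num at this
  refine this.congr' ?_
  filter_upwards [eventually_ge_atTop 1] with n hn
  have hn0 : (0 : ℝ) < n := by exact_mod_cast hn
  have p3 := pow3 hn0.le (⌈K * Real.log n⌉₊ : ℝ) 2
  have p4 := pow3 hn0.le (⌈K * Real.log n⌉₊ : ℝ) (1 + ε)
  rw [p3, p4]
  have q1 : (n : ℝ) ^ (-1 : ℝ) = (n : ℝ)⁻¹ := Real.rpow_neg_one _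
  have q2 : (n : ℝ) ^ (-2 : ℝ) = ((n : ℝ) ^ 2)⁻¹ := by
    rw [Real.rpow_neg hn0.le]; norm_num
  have q3 : (n : ℝ) ^ (-(1 + ε)) = (n : ℝ) ^ (-ε) * (n : ℝ)⁻¹ := by
    rw [← q1, ← Real.rpow_add hn0]; congr 1; ring
  rw [q1, q2, q3]
  unfold RR
  rw [q3]
  field_simp
  ring

end Prob
end GM


namespace GM
open MvPolynomial

section Fin
set_option linter.unusedSectionVars false
variable {Ω : Type*} [MeasureSpace Ω] [IsProbabilityMeasure (volume : Measure Ω)]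

structure Hyp (X : (n : ℕ) → Ω → Matrix (Fin n) (Fin n) ℝ) (C ε : ℝ) : Prop where
  symm : ∀ n ω, (X n ω).IsSymm
  gv : ∀ n, GV (volume : Measure Ω) (fun p : Fin n × Fin n => fun ω => X n ω p.1 p.2)
  hC : 0 < C
  hε : 0 < ε
  hvar : ∀ n : ℕ, 2 ≤ n → ∀ i j : Fin n,
      |pvar (fun ω => X n ω i j) - 1| ≤ C / Real.log n ^ 2
  hcorr : ∀ n : ℕ, ∀ i j i' j' : Fin n,
      ¬((i, j) = (i', j') ∨ (i, j) = (j', i')) →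
      |∫ ω, X n ω i j * X n ω i' j'| ≤ C * (n : ℝ) ^ (-(1 + ε))

variable {X : (n : ℕ) → Ω → Matrix (Fin n) (Fin n) ℝ} {C ε : ℝ}

lemma Hyp.mb (H : Hyp X C ε) (K : ℝ) (hK : 0 ≤ K) :
    ∃ ρ : ℕ → ℝ, Tendsto ρ atTop (𝓝 1) ∧ (∀ n, 1 ≤ ρ n) ∧ ∀ n, 2 ≤ n →
      MB (H.gv n).E (1 + C / Real.log n ^ 2) (C * (n : ℝ) ^ (-(1 + ε))) (ρ n)
        ⌈K * Real.log n⌉₊ := by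
  refine ⟨fun n => max 1 (RR C ε K n), ?_, fun n => le_max_left _ _, ?_⟩
  · simpa using (tendsto_const_nhds (x := (1 : ℝ))).max (tendsto_RR C ε K H.hε hK)
  · intro n hn
    have hC := H.hC
    apply bounds (H.gv n)
    · intro i j ω
      exact (H.symm n ω).apply j i
    · positivity
    · positivity
    · simp; omega
    · rintro ⟨i, j⟩
      have h0 : ∫ ω, X n ω i j = 0 := by
        have h1 := (H.gv n).isGF.ibp (i, j) 1
        have h2 := (H.gv n).E_apply (MvPolynomial.X (i, j))
        simp at h1 h2
        rw [← h2, h1]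
      have := H.hvar n hn i j
      simpa [pvar, pcov, h0] using this
    · rintro ⟨i, j⟩ ⟨i', j'⟩ h1 h2
      apply H.hcorr
      rintro (h | h)
      · exact h1 h.symm
      · apply h2
        simp at h ⊢
        exact ⟨h.2.symm, h.1.symm⟩
    · exact le_max_left _ _
    · refine le_trans (le_of_eq ?_) (le_max_right _ _)
      simp [RR]

/-- trace of a power -/
noncomputable def Tr (X : (n : ℕ) → Ω → Matrix (Fin n) (Fin n) ℝ) (n m : ℕ) (ω : Ω) : ℝ :=
  ∑ i, ((X n ω) ^ m) i i

lemma Tr_eval (n m : ℕ) (ω : Ω) :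
    Tr X n m ω = eval (fun p : Fin n × Fin n => X n ω p.1 p.2) (TT (Fin n) m) := by
  rw [eval_TT]; rfl

lemma Hyp.int (H : Hyp X C ε) (n m : ℕ) : Integrable (Tr X n m) := by
  have := (H.gv n).integrable (TT (Fin n) m)
  refine this.congr (Eventually.of_forall fun ω => ?_)
  simp [Tr_eval]

lemma Hyp.int2 (H : Hyp X C ε) (n m : ℕ) : Integrable (fun ω => Tr X n m ω * Tr X n m ω) := by
  have := (H.gv n).integrable (TT (Fin n) m * TT (Fin n) m)
  refine this.congr (Eventually.of_forall fun ω => ?_)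
  simp [Tr_eval]

lemma Hyp.mean (H : Hyp X C ε) (n m : ℕ) :
    ∫ ω, Tr X n m ω = (H.gv n).E (TT (Fin n) m) := by
  rw [GV.E_apply]
  simp only [Tr_eval]

lemma Hyp.mean2 (H : Hyp X C ε) (n m : ℕ) :
    ∫ ω, Tr X n m ω * Tr X n m ω = (H.gv n).E (TT (Fin n) m * TT (Fin n) m) := by
  rw [GV.E_apply]
  simp only [Tr_eval, map_mul]

lemma Tr_nonneg (H : Hyp X C ε) (n k : ℕ) (ω : Ω) : 0 ≤ Tr X n (2 * k) ω := by
  rcases Nat.eq_zero_or_pos n with h | h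
  · subst h; simp [Tr]
  · obtain ⟨l, h1, -⟩ := lam1_spec h (X n ω) (H.symm n ω)
    rw [Tr, h1]
    exact Finset.sum_nonneg fun i _ => by rw [pow_mul]; positivity

noncomputable def rr (n : ℕ) : ℝ := (n : ℝ) ^ (-(1 / 2) : ℝ)

lemma rr_sq (n : ℕ) : rr n ^ 2 = (n : ℝ)⁻¹ := by
  rw [rr, ← Real.rpow_natCast, ← Real.rpow_mul (Nat.cast_nonneg n)]
  norm_num
  exact Real.rpow_neg_one _

lemma Tr_smul (n m : ℕ) (ω : Ω) :
    ∑ i, ((((n : ℝ) ^ (-(1 / 2) : ℝ)) • X n ω) ^ m) i i = rr n ^ m * Tr X n m ω := by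
  simp [smul_pow, Tr, Finset.mul_sum, rr]

lemma catalan_le (k : ℕ) : (catalan k : ℝ) ≤ 4 ^ k := by
  have h1 := succ_mul_catalan_eq_centralBinom k
  have h2 := Nat.centralBinom_le_four_pow k
  have h3 : catalan k ≤ 4 ^ k := by nlinarith [Nat.zero_le (k * catalan k)]
  exact_mod_cast h3

lemma L_tendsto (K : ℝ) (hK : 0 < K) :
    Tendsto (fun n : ℕ => ⌈K * Real.log n⌉₊) atTop atTop := by
  apply tendsto_nat_ceil_atTop.comp
  exact (Real.tendsto_log_atTop.comp tendsto_natCast_atTop_atTop).const_mul_atTop hK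

lemma Hyp.upper (H : Hyp X C ε) (s : ℝ) (hs : 2 < s) :
    ∀ᵐ ω, ∀ᶠ n : ℕ in atTop, lam1 (((n : ℝ) ^ (-(1 / 2) : ℝ)) • X n ω) < s := by
  have hs0 : 0 < s := by linarith
  have h4 : 4 / s ^ 2 < 1 := by
    rw [div_lt_one (by positivity)]; nlinarith
  obtain ⟨θ, hθ1, hθ2⟩ := exists_between h4
  have hθ0 : 0 < θ := lt_trans (by positivity) hθ1
  have hlog : Real.log θ < 0 := Real.log_neg hθ0 hθ2
  set K : ℝ := 3 / (-Real.log θ) with hKdef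
  have hK : 0 < K := div_pos (by norm_num) (by linarith)
  obtain ⟨ρ, hρ, hρ1, hmb⟩ := H.mb K hK.le
  let L : ℕ → ℕ := fun n => ⌈K * Real.log n⌉₊
  have key : ∀ᵐ ω, Tendsto (fun n : ℕ =>
      ((n : ℝ)⁻¹ ^ (L n) / s ^ (2 * L n)) * Tr X n (2 * L n) ω) atTop (𝓝 0) := by
    refine ae_tendsto_zero (fun (n : ℕ) ω =>
      ((n : ℝ)⁻¹ ^ (L n) / s ^ (2 * L n)) * Tr X n (2 * L n) ω)
      (fun n ω => mul_nonneg (by positivity) (Tr_nonneg H n _ ω))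
      (fun n => (H.int n _).const_mul _) (fun n : ℕ => 1 / (n : ℝ) ^ 2)
      (Real.summable_one_div_nat_pow.mpr (by norm_num)) ?_
    have hev : ∀ᶠ n in atTop, ρ n * (4 / s ^ 2) < θ := by
      have := hρ.mul_const (4 / s ^ 2)
      rw [one_mul] at this
      exact this.eventually_lt_const hθ1
    filter_upwards [hev, eventually_ge_atTop 2] with n h1 h2
    have hn0 : (0 : ℝ) < n := by positivity
    rw [integral_const_mul, H.mean]
    have h3 := (hmb n h2).up (L n) le_rfl
    rw [Fintype.card_fin] at h3
    have hr0 : 0 ≤ ρ n := by linarith [hρ1 n]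
    have h5 : θ ^ (L n) ≤ 1 / (n : ℝ) ^ 3 := by
      rw [← Real.rpow_natCast, Real.rpow_def_of_pos hθ0]
      have h6 : K * Real.log n ≤ L n := Nat.le_ceil _
      have h7 : Real.log θ * (L n) ≤ - (3 * Real.log n) := by
        have h8 : Real.log θ * L n ≤ Real.log θ * (K * Real.log n) :=
          mul_le_mul_of_nonpos_left h6 hlog.le
        have h9 : Real.log θ * (K * Real.log n) = - (3 * Real.log n) := by
          rw [hKdef]; have := hlog.ne; field_simp
        linarith
      refine (Real.exp_le_exp.mpr h7).trans (le_of_eq ?_)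
      rw [Real.exp_neg, ← Real.exp_log (show (0 : ℝ) < (n : ℝ) ^ 3 by positivity), Real.log_pow]
      simp
    calc _ ≤ ((n : ℝ)⁻¹ ^ (L n) / s ^ (2 * L n)) * ((n : ℝ) ^ (L n + 1) *
          (ρ n ^ (L n) * 4 ^ (L n))) := by
          refine mul_le_mul_of_nonneg_left (h3.trans ?_) (by positivity)
          gcongr
          exact catalan_le _
      _ = n * (ρ n * (4 / s ^ 2)) ^ (L n) := by
          rw [mul_pow, div_pow, ← pow_mul, inv_pow]
          field_simp
          ring
      _ ≤ n * θ ^ (L n) := by gcongr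
      _ ≤ n * (1 / (n : ℝ) ^ 3) := by gcongr
      _ = _ := by field_simp
  filter_upwards [key] with ω hω
  filter_upwards [hω.eventually_lt_const (zero_lt_one' ℝ), eventually_ge_atTop 1] with n h1 h2
  refine lam1_lt h2 _ ((H.symm n ω).smul _) s hs0.le (L n) ?_
  rw [Tr_smul, pow_mul, rr_sq]
  rw [div_mul_eq_mul_div, div_lt_one (by positivity)] at h1
  exact h1

lemma Hyp.conc (H : Hyp X C ε) (j : ℕ) :
    ∀ᵐ ω, Tendsto (fun n : ℕ => rr n ^ (j + 1) / n *
      (Tr X n (j + 1) ω - (H.gv n).E (TT (Fin n) (j + 1)))) atTop (𝓝 0) := by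
  obtain ⟨ρ, hρ, hρ1, hmb⟩ := H.mb 1 zero_le_one
  have key : ∀ᵐ ω, Tendsto (fun n : ℕ => (rr n ^ (j + 1) / n *
      (Tr X n (j + 1) ω - (H.gv n).E (TT (Fin n) (j + 1)))) ^ 2) atTop (𝓝 0) := by
    have hexp : ∀ (n : ℕ) (ω : Ω), (rr n ^ (j + 1) / n *
      (Tr X n (j + 1) ω - (H.gv n).E (TT (Fin n) (j + 1)))) ^ 2 =
        (rr n ^ (j + 1) / n) ^ 2 * (Tr X n (j + 1) ω * Tr X n (j + 1) ω -
          (2 * (H.gv n).E (TT (Fin n) (j + 1))) * Tr X n (j + 1) ω +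
          (H.gv n).E (TT (Fin n) (j + 1)) * (H.gv n).E (TT (Fin n) (j + 1))) := by
      intro n ω; ring
    have hC := H.hC
    have hε := H.hε
    refine ae_tendsto_zero (fun (n : ℕ) ω => (rr n ^ (j + 1) / n *
      (Tr X n (j + 1) ω - (H.gv n).E (TT (Fin n) (j + 1)))) ^ 2)
      (fun n ω => sq_nonneg _) (fun n => ?_)
      (fun n : ℕ => ((j + 1) * (j + 1) * (2 ^ j * catalan j)) *
        (4 * (1 / (n : ℝ) ^ 2) + C * (1 / (n : ℝ) ^ (1 + ε)))) ?_ ?_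
    · simp only [hexp]
      exact (((H.int2 n _).sub ((H.int n _).const_mul _)).add (integrable_const _)).const_mul _
    · apply Summable.mul_left
      exact ((Real.summable_one_div_nat_pow.mpr (by norm_num)).mul_left 4).add
        ((Real.summable_one_div_nat_rpow.mpr (by linarith)).mul_left C)
    · filter_upwards [eventually_ge_atTop 2, hρ.eventually_le_const one_lt_two,
        (tendsto_alpha C).eventually_le_const one_lt_two,
        (L_tendsto 1 one_pos).eventually_ge_atTop j] with n h2 hr2 ha2 hj
      have hn0 : (0 : ℝ) < n := by positivity
      have hv := (hmb n h2).var j hj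
      rw [Fintype.card_fin] at hv
      have hInt2 : ∫ ω, (rr n ^ (j + 1) / n *
          (Tr X n (j + 1) ω - (H.gv n).E (TT (Fin n) (j + 1)))) ^ 2 =
          (rr n ^ (j + 1) / n) ^ 2 * ((H.gv n).E (TT (Fin n) (j + 1) * TT (Fin n) (j + 1)) -
          (H.gv n).E (TT (Fin n) (j + 1)) * (H.gv n).E (TT (Fin n) (j + 1))) := by
        simp only [hexp]
        rw [integral_const_mul]
        congr 1
        have i1 : Integrable (fun ω => Tr X n (j + 1) ω * Tr X n (j + 1) ω -
          (2 * (H.gv n).E (TT (Fin n) (j + 1))) * Tr X n (j + 1) ω) :=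
          (H.int2 n _).sub ((H.int n _).const_mul _)
        have e1 := integral_add i1
          (integrable_const ((H.gv n).E (TT (Fin n) (j + 1)) * (H.gv n).E (TT (Fin n) (j + 1))))
        have e2 := integral_sub (H.int2 n (j + 1))
          ((H.int n (j + 1)).const_mul (2 * (H.gv n).E (TT (Fin n) (j + 1))))
        refine e1.trans ?_
        rw [e2, integral_const_mul, H.mean, H.mean2]
        simp
        ring
      rw [hInt2]
      have hr0 : 0 ≤ ρ n := by linarith [hρ1 n]
      have hrr : (rr n ^ (j + 1) / n) ^ 2 = (n : ℝ)⁻¹ ^ (j + 1) * ((n : ℝ) ^ 2)⁻¹ := by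
        rw [div_pow, ← pow_mul, mul_comm (j + 1) 2, pow_mul, rr_sq, div_eq_mul_inv]
      rw [hrr]
      have hb : (n : ℝ) ^ (-(1 + ε)) = 1 / (n : ℝ) ^ (1 + ε) := by
        rw [Real.rpow_neg hn0.le, one_div]
      calc _ ≤ (n : ℝ)⁻¹ ^ (j + 1) * ((n : ℝ) ^ 2)⁻¹ * ((j + 1) * (j + 1) *
            ((2 * 2 + C * (n : ℝ) ^ (-(1 + ε)) * (n : ℝ) ^ 2) *
              ((n : ℝ) ^ (j + 1) * (2 ^ j * catalan j)))) := by
            refine mul_le_mul_of_nonneg_left (hv.trans ?_) (by positivity)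
            gcongr
        _ = _ := by
            rw [hb, inv_pow]
            field_simp
            ring
  filter_upwards [key] with ω hω
  have := hω.sqrt
  simp only [Real.sqrt_sq_eq_abs, Real.sqrt_zero] at this
  exact (tendsto_zero_iff_abs_tendsto_zero _).mpr this

lemma Hyp.meanlim (H : Hyp X C ε) (k : ℕ) :
    Tendsto (fun n : ℕ => rr n ^ (2 * k) / n * (H.gv n).E (TT (Fin n) (2 * k))) atTop
      (𝓝 (catalan k)) := by
  obtain ⟨ρ, hρ, hρ1, hmb⟩ := H.mb 1 zero_le_one
  have h1 : Tendsto (fun n => ρ n ^ k * catalan k) atTop (𝓝 (catalan k)) := by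
    simpa using (hρ.pow k).mul_const (catalan k : ℝ)
  have h2 : Tendsto (fun n => (2 - ρ n ^ k) * catalan k) atTop (𝓝 (catalan k)) := by
    have := ((hρ.pow k).const_sub 2).mul_const (catalan k : ℝ)
    norm_num at this
    exact this
  have hid : ∀ n : ℕ, 2 ≤ n → ∀ y : ℝ, y = rr n ^ (2 * k) / n * ((n : ℝ) ^ (k + 1) * y) := by
    intro n hn y
    have hn0 : (0 : ℝ) < n := by positivity
    rw [pow_mul, rr_sq, inv_pow]
    field_simp
    ring
  have hpos : ∀ n : ℕ, 0 ≤ rr n ^ (2 * k) / n := by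
    intro n
    rw [pow_mul]; positivity
  refine tendsto_of_tendsto_of_tendsto_of_le_of_le' h2 h1 ?_ ?_
  · filter_upwards [eventually_ge_atTop 2, (L_tendsto 1 one_pos).eventually_ge_atTop k]
      with n hn hk
    have := (hmb n hn).low k hk
    rw [Fintype.card_fin] at this
    rw [hid n hn ((2 - ρ n ^ k) * catalan k)]
    exact mul_le_mul_of_nonneg_left this (hpos n)
  · filter_upwards [eventually_ge_atTop 2, (L_tendsto 1 one_pos).eventually_ge_atTop k]
      with n hn hk
    have := (hmb n hn).up k hk
    rw [Fintype.card_fin] at this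
    rw [hid n hn (ρ n ^ k * catalan k)]
    exact mul_le_mul_of_nonneg_left this (hpos n)

lemma Hyp.evenlim (H : Hyp X C ε) (k : ℕ) :
    ∀ᵐ ω, Tendsto (fun n : ℕ => rr n ^ (2 * k + 2) / n * Tr X n (2 * k + 2) ω) atTop
      (𝓝 (catalan (k + 1))) := by
  filter_upwards [H.conc (2 * k + 1)] with ω hω
  have := hω.add (H.meanlim (k + 1))
  rw [zero_add] at this
  refine this.congr fun n => ?_
  rw [show 2 * (k + 1) = 2 * k + 1 + 1 by ring, show 2 * k + 2 = 2 * k + 1 + 1 by ring]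
  ring

lemma Hyp.oddlim (H : Hyp X C ε) (k : ℕ) :
    ∀ᵐ ω, Tendsto (fun n : ℕ => rr n ^ (2 * k + 1) / n * Tr X n (2 * k + 1) ω) atTop
      (𝓝 0) := by
  filter_upwards [H.conc (2 * k)] with ω hω
  refine hω.congr fun n => ?_
  rw [(H.gv n).E_odd (2 * k + 1) (odd_two_mul_add_one k), sub_zero]

lemma catalan_rec (q : ℕ) : ((q : ℝ) + 2) * catalan (q + 1) = 2 * (2 * q + 1) * catalan q := by
  have h1 := succ_mul_catalan_eq_centralBinom q
  have h2 := succ_mul_catalan_eq_centralBinom (q + 1)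
  have h3 := Nat.succ_mul_centralBinom_succ q
  rw [← h1, ← h2] at h3
  have h4 : (q + 1) * ((q + 2) * catalan (q + 1)) = (q + 1) * (2 * (2 * q + 1) * catalan q) := by
    rw [show q + 2 = q + 1 + 1 by ring, h3]; ring
  have h5 := Nat.eq_of_mul_eq_mul_left (Nat.succ_pos q) h4
  exact_mod_cast h5

lemma catalan_pos' (q : ℕ) : 0 < catalan q := by
  have h1 := succ_mul_catalan_eq_centralBinom q
  have h2 := Nat.centralBinom_pos q
  rw [← h1] at h2
  exact Nat.pos_of_mul_pos_left h2

lemma Hyp.lower (H : Hyp X C ε) (b : ℝ) (hb : b < 2) :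
    ∀ᵐ ω, ∀ᶠ n : ℕ in atTop, b < lam1 (((n : ℝ) ^ (-(1 / 2) : ℝ)) • X n ω) := by
  obtain ⟨p, hp⟩ := exists_nat_gt (2 / (2 - b))
  rw [div_lt_iff₀ (by linarith)] at hp
  filter_upwards [H.oddlim (p + 2), H.oddlim (p + 1), H.evenlim (p + 1), H.evenlim p]
    with ω o5 o3 e4 e2
  set c1 : ℝ := ((catalan (p + 1 + 1) : ℕ) : ℝ) with hc1
  set c0 : ℝ := ((catalan (p + 1) : ℕ) : ℝ) with hc0
  have hc0p : 0 < c0 := by rw [hc0]; exact_mod_cast catalan_pos' _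
  have hc1p : 0 < c1 := by rw [hc1]; exact_mod_cast catalan_pos' _
  have hrec := catalan_rec (p + 1)
  rw [← hc0, ← hc1] at hrec
  push_cast at hrec
  have hN := (o5.add (e4.const_mul 4)).add (o3.const_mul 4)
  have hD := (e4.add (o3.const_mul 4)).add (e2.const_mul 4)
  have hlim := hN.sub (hD.const_mul b)
  have hpos : 0 < (0 + 4 * c1 + 4 * 0) - b * (c1 + 4 * 0 + 4 * c0) := by
    have h6 : 0 < ((p : ℝ) + 3) * ((0 + 4 * c1 + 4 * 0) - b * (c1 + 4 * 0 + 4 * c0)) := by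
      have : ((p : ℝ) + 3) * ((0 + 4 * c1 + 4 * 0) - b * (c1 + 4 * 0 + 4 * c0)) =
        c0 * ((4 - b) * (2 * (2 * (p + 1) + 1)) - 4 * b * (p + 3)) := by
        linear_combination (4 - b) * hrec
      rw [this]
      apply mul_pos hc0p
      nlinarith
    exact pos_of_mul_pos_right h6 (by positivity)
  have hDpos : 0 < c1 + 4 * 0 + 4 * c0 := by positivity
  filter_upwards [hlim.eventually_const_lt hpos, hD.eventually_const_lt hDpos,
    eventually_ge_atTop 1] with n h1 h2 hn
  have hn0 : (0 : ℝ) < n := by exact_mod_cast hn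
  have hge := lam1_ge hn _ ((H.symm n ω).smul ((n : ℝ) ^ (-(1 / 2) : ℝ))) (p + 1)
  simp only [Tr_smul] at hge
  set l := lam1 (((n : ℝ) ^ (-(1 / 2) : ℝ)) • X n ω)
  simp only [
    show 2 * (p + 1) = 2 * p + 2 by ring] at hge h1 h2
  have hge' := div_le_div_of_nonneg_right hge hn0.le
  have hge'' : rr n ^ (2 * (p + 2) + 1) / n * Tr X n (2 * (p + 2) + 1) ω +
      4 * (rr n ^ (2 * p + 2 + 2) / n * Tr X n (2 * p + 2 + 2) ω) +
      4 * (rr n ^ (2 * p + 2 + 1) / n * Tr X n (2 * p + 2 + 1) ω) ≤ l *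
      (rr n ^ (2 * p + 2 + 2) / n * Tr X n (2 * p + 2 + 2) ω +
      4 * (rr n ^ (2 * p + 2 + 1) / n * Tr X n (2 * p + 2 + 1) ω) +
      4 * (rr n ^ (2 * p + 2) / n * Tr X n (2 * p + 2) ω)) := by
    refine le_trans (le_of_eq ?_) (hge'.trans (le_of_eq ?_)) <;> ring_nf
  refine lt_of_mul_lt_mul_right ?_ h2.le
  linarith

theorem Hyp.final (H : Hyp X C ε) : ∀ᵐ ω ∂(volume : Measure Ω),
      Tendsto (fun n : ℕ => lam1 (((n : ℝ) ^ (-(1 / 2) : ℝ)) • X n ω)) atTop (𝓝 2) := by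
  have hu : ∀ᵐ ω, ∀ j : ℕ, ∀ᶠ n : ℕ in atTop,
      lam1 (((n : ℝ) ^ (-(1 / 2) : ℝ)) • X n ω) < 2 + 1 / ((j : ℝ) + 1) :=
    ae_all_iff.mpr fun j => H.upper _ (by
      have : (0 : ℝ) < 1 / ((j : ℝ) + 1) := by positivity
      linarith)
  have hl : ∀ᵐ ω, ∀ j : ℕ, ∀ᶠ n : ℕ in atTop,
      2 - 1 / ((j : ℝ) + 1) < lam1 (((n : ℝ) ^ (-(1 / 2) : ℝ)) • X n ω) :=
    ae_all_iff.mpr fun j => H.lower _ (by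
      have : (0 : ℝ) < 1 / ((j : ℝ) + 1) := by positivity
      linarith)
  filter_upwards [hu, hl] with ω h1 h2
  rw [tendsto_order]
  constructor
  · intro a ha
    obtain ⟨j, hj⟩ := exists_nat_one_div_lt (sub_pos.mpr ha)
    filter_upwards [h2 j] with n hn
    linarith
  · intro a ha
    obtain ⟨j, hj⟩ := exists_nat_one_div_lt (sub_pos.mpr ha)
    filter_upwards [h1 j] with n hn
    linarith

end Fin
end GM


/-- centered Gaussian symmetric matrices with variances close to `1`
(within `C/(log n)²`) and pairwise correlations bounded by `C n^{-(1+ε)}`: the largest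
eigenvalue of `n^{-1/2} X_n` converges to `2` almost surely. -/
theorem largest_eigenvalue_tendsto_two_approx_var
    {Ω : Type*} [MeasureSpace Ω] [IsProbabilityMeasure (volume : Measure Ω)]
    (X : (n : ℕ) → Ω → Matrix (Fin n) (Fin n) ℝ)
    (hsymm : ∀ n ω, (X n ω).IsSymm)
    (hgauss : ∀ n, IsCenteredGaussianVec fun p : Fin n × Fin n => fun ω => X n ω p.1 p.2)
    (C ε : ℝ) (hC : 0 < C) (hε : 0 < ε)
    (hvar : ∀ n : ℕ, 2 ≤ n → ∀ i j : Fin n,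
      |pvar (fun ω => X n ω i j) - 1| ≤ C / Real.log n ^ 2)
    (hcorr : ∀ n : ℕ, ∀ i j i' j' : Fin n,
      ¬((i, j) = (i', j') ∨ (i, j) = (j', i')) →
      |∫ ω, X n ω i j * X n ω i' j'| ≤ C * (n : ℝ) ^ (-(1 + ε))) :
    ∀ᵐ ω ∂(volume : Measure Ω),
      Tendsto (fun n : ℕ => lam1 (((n : ℝ) ^ (-(1 / 2) : ℝ)) • X n ω)) atTop (𝓝 2) := by
  exact GM.Hyp.final ⟨hsymm, hgauss, hC, hε, hvar, hcorr⟩
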